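/- Let 𝓘 be the class of finite labelled posets (S,μ) such that E(S,μ) is real-rooted and E(S∖x, μ) ⪯ E(S,μ) for every x ∈ S (where μ also denotes its restriction to S∖x). If (P,ω) ∈ 𝓘 and (Q,ν) ∈ 𝓘, then (P ⊕ Q, ω ⊕₀ ν) ∈ 𝓘, (P ⊕ Q, ω ⊕₁ ν) ∈ 𝓘, and (P ⊔ Q, ω ⊔ ν) ∈ 𝓘; that is, 𝓘 is closed under ordinal sum (with either labelling) and disjoint union. -/

import Mathlib

open Polynomial

/-- A real polynomial is real-rooted if it is nonzero and all of its complex zeros are real. -/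
def RealRooted (f : Polynomial ℝ) : Prop :=
  f ≠ 0 ∧ ∀ z : ℂ, (f.map (algebraMap ℝ ℂ)).IsRoot z → z.im = 0

/-- The zeros of `f`, listed in increasing order (with multiplicity). -/
noncomputable def sortedRoots (f : Polynomial ℝ) : List ℝ :=
  f.roots.sort (· ≤ ·)

/-- `g ⪯ f`: interlacing. Both are real-rooted, `deg f = deg g + 1`, and listing the zeros of
`f` as `α₁ ≤ ⋯ ≤ α_d` and of `g` as `β₁ ≤ ⋯ ≤ β_{d-1}` (with multiplicity, in increasing
order), one has `α₁ ≤ β₁ ≤ α₂ ≤ ⋯ ≤ β_{d-1} ≤ α_d`. -/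
def Interlaces (g f : Polynomial ℝ) : Prop :=
  RealRooted f ∧ RealRooted g ∧ f.natDegree = g.natDegree + 1 ∧
  ∀ i, i < g.natDegree →
    (sortedRoots f).getD i 0 ≤ (sortedRoots g).getD i 0 ∧
    (sortedRoots g).getD i 0 ≤ (sortedRoots f).getD (i + 1) 0

/-- `g ≺ f`: strict interlacing, where all the inequalities above are strict. -/
def StrictInterlaces (g f : Polynomial ℝ) : Prop :=
  RealRooted f ∧ RealRooted g ∧ f.natDegree = g.natDegree + 1 ∧
  ∀ i, i < g.natDegree →
    (sortedRoots f).getD i 0 < (sortedRoots g).getD i 0 ∧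
    (sortedRoots g).getD i 0 < (sortedRoots f).getD (i + 1) 0

/-- `σ : P → {1,…,k}` (realised as `Fin k`) is a `(P,ω)`-partition if it is order reversing
and `x < y` with `ω x > ω y` implies `σ x > σ y`. -/
def IsPPartition {α : Type*} [PartialOrder α] (ω : α → ℕ) {k : ℕ} (σ : α → Fin k) : Prop :=
  (∀ x y : α, x ≤ y → σ y ≤ σ x) ∧ (∀ x y : α, x < y → ω y < ω x → σ y < σ x)

/-- The `E`-polynomial `E(P,ω) = Σₖ e_k(P,ω) xᵏ`, where `e_k(P,ω)` is the number of
surjective `(P,ω)`-partitions `σ : P → {1,…,k}`. -/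
noncomputable def Epoly (α : Type*) [PartialOrder α] (ω : α → ℕ) : Polynomial ℝ :=
  ∑ k ∈ Finset.range (Nat.card α + 1),
    C ((Nat.card {σ : α → Fin k // Function.Surjective σ ∧ IsPPartition ω σ} : ℕ) : ℝ) * X ^ k

instance (α β : Type*) [Finite α] [Finite β] : Finite (α ⊕ₗ β) :=
  inferInstanceAs (Finite (α ⊕ β))

/-- The class `𝓘` of finite labelled posets `(S,μ)` such that `E(S,μ)` is real-rooted and
`E(S∖x, μ) ⪯ E(S,μ)` for every `x ∈ S`. -/
def MemI (α : Type*) [PartialOrder α] [Finite α] (ω : α → ℕ) : Prop :=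
  Function.Injective ω ∧ RealRooted (Epoly α ω) ∧
  ∀ x : α, Interlaces (Epoly {y : α // y ≠ x} (fun y => ω y.val)) (Epoly α ω)

/-! ### Interlacing and the upper half plane -/

/-- The phase of `f` at `t + i / u`, measured relative to the phase of `(i / u) ^ deg f`. -/
noncomputable def rootPhase (f : ℝ[X]) (t u : ℝ) : ℝ :=
  ∑ i ∈ Finset.range f.natDegree, Real.arctan ((t - (sortedRoots f).getD i 0) * u)

/-- `f + s h` has no zeros in the upper half plane for all `s` in the upper half plane. -/
def NonvanishingPencil (h f : ℝ[X]) : Prop :=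
  ∀ z s : ℂ, 0 < z.im → 0 < s.im → aeval z f + s * aeval z h ≠ 0

theorem RealRooted.splits {f : ℝ[X]} (hf : RealRooted f) : f.Splits := by
  refine Splits.of_splits_map (algebraMap ℝ ℂ) (IsAlgClosed.splits _) ?_
  intro z hz
  refine ⟨z.re, ?_⟩
  have := hf.2 z (isRoot_of_mem_roots hz)
  apply Complex.ext <;> simp [this]

theorem RealRooted.aeval_ne_zero {f : ℝ[X]} (hf : RealRooted f) {z : ℂ} (hz : 0 < z.im) :
    aeval z f ≠ 0 := by
  intro h
  refine hz.ne' (hf.2 z ?_)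
  rwa [IsRoot, eval_map_algebraMap]

theorem realRooted_of_aeval_ne_zero {f : ℝ[X]} (hf : ∀ z : ℂ, 0 < z.im → aeval z f ≠ 0) :
    RealRooted f := by
  refine ⟨?_, fun z hz => ?_⟩
  · rintro rfl
    exact hf Complex.I (by simp) (by simp)
  · rw [IsRoot, eval_map_algebraMap] at hz
    rcases lt_trichotomy z.im 0 with h | h | h
    · refine absurd ?_ (hf ((starRingEnd ℂ) z) (by simpa using h))
      rw [aeval_conj, hz, map_zero]
    · exact h
    · exact absurd hz (hf z h)

theorem RealRooted.mul {f g : ℝ[X]} (hf : RealRooted f) (hg : RealRooted g) :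
    RealRooted (f * g) :=
  realRooted_of_aeval_ne_zero fun z hz => by
    rw [map_mul]
    exact mul_ne_zero (hf.aeval_ne_zero hz) (hg.aeval_ne_zero hz)

theorem RealRooted.length_sortedRoots {f : ℝ[X]} (hf : RealRooted f) :
    (sortedRoots f).length = f.natDegree := by
  rw [sortedRoots, Multiset.length_sort, hf.splits.natDegree_eq_card_roots]

theorem sortedRoots_getD_mono {f : ℝ[X]} {i j : ℕ} (hij : i ≤ j)
    (hj : j < (sortedRoots f).length) :
    (sortedRoots f).getD i 0 ≤ (sortedRoots f).getD j 0 := by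
  rw [List.getD_eq_getElem _ _ hj, List.getD_eq_getElem _ _ (hij.trans_lt hj)]
  exact (Multiset.pairwise_sort f.roots (· ≤ ·)).rel_get_of_le
    (a := ⟨i, hij.trans_lt hj⟩) (b := ⟨j, hj⟩) hij

theorem list_prod_map_eq_prod_range {M : Type*} [CommMonoid M] (l : List ℝ) (φ : ℝ → M) :
    (l.map φ).prod = ∏ i ∈ Finset.range l.length, φ (l.getD i 0) := by
  rw [Finset.prod_range]
  simp [← List.prod_ofFn]

theorem RealRooted.aeval_eq_prod {f : ℝ[X]} (hf : RealRooted f) (z : ℂ) :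
    aeval z f = f.leadingCoeff *
      ∏ i ∈ Finset.range f.natDegree, (z - ((sortedRoots f).getD i 0 : ℝ)) := by
  conv_lhs => rw [hf.splits.eq_prod_roots]
  rw [← hf.length_sortedRoots, ← list_prod_map_eq_prod_range (sortedRoots f) fun r => z - (r : ℂ)]
  rw [← Multiset.prod_coe, ← Multiset.map_coe, sortedRoots, Multiset.sort_eq]
  simp [map_multiset_prod]

theorem one_sub_mul_I_eq_exp (c : ℝ) :
    1 - (c : ℂ) * Complex.I =
      (√(1 + c ^ 2) : ℝ) * Complex.exp (-(Real.arctan c : ℝ) * Complex.I) := by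
  have h : (0 : ℝ) < √(1 + c ^ 2) := Real.sqrt_pos.2 (by positivity)
  rw [← Complex.ofReal_neg, Complex.exp_mul_I, ← Complex.ofReal_cos, ← Complex.ofReal_sin,
    Real.cos_neg, Real.sin_neg, Real.cos_arctan, Real.sin_arctan]
  apply Complex.ext <;> simp <;> field_simp

theorem RealRooted.aeval_eq_exp {f : ℝ[X]} (hf : RealRooted f) (t : ℝ) {u : ℝ} (hu : 0 < u) :
    ∃ R : ℝ, 0 < R ∧ aeval ((t : ℂ) + Complex.I / u) f =
      f.leadingCoeff * (Complex.I / u) ^ f.natDegree * R *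
        Complex.exp (-(rootPhase f t u : ℝ) * Complex.I) := by
  have hu' : (u : ℂ) ≠ 0 := by exact_mod_cast hu.ne'
  refine ⟨∏ i ∈ Finset.range f.natDegree, √(1 + ((t - (sortedRoots f).getD i 0) * u) ^ 2),
    Finset.prod_pos fun i _ => Real.sqrt_pos.2 (by positivity), ?_⟩
  rw [hf.aeval_eq_prod, rootPhase, Complex.ofReal_sum, ← Finset.sum_neg_distrib, Finset.sum_mul,
    Complex.exp_sum, Complex.ofReal_prod, mul_assoc, mul_assoc, ← Finset.prod_mul_distrib,
    ← Finset.card_range f.natDegree, ← Finset.prod_const, Finset.card_range,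
    ← Finset.prod_mul_distrib]
  congr 1
  refine Finset.prod_congr rfl fun i _ => ?_
  rw [← one_sub_mul_I_eq_exp]
  push_cast
  field_simp
  ring_nf
  rw [Complex.I_sq]
  ring

theorem nonvanishingPencil_iff {h f : ℝ[X]} (hf : RealRooted f) (hh : RealRooted h)
    (hd : f.natDegree = h.natDegree + 1) (hfl : 0 < f.leadingCoeff) (hhl : 0 < h.leadingCoeff) :
    NonvanishingPencil h f ↔
      ∀ t u : ℝ, 0 < u → 0 ≤ Real.cos (rootPhase f t u - rootPhase h t u) := by
  have key : ∀ t u : ℝ, 0 < u → ∃ ρ : ℝ, 0 < ρ ∧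
      aeval ((t : ℂ) + Complex.I / u) f = aeval ((t : ℂ) + Complex.I / u) h *
        (Complex.I * ρ * Complex.exp ((-(rootPhase f t u - rootPhase h t u) : ℝ) * Complex.I)) := by
    intro t u hu
    obtain ⟨R, hR, h1⟩ := hf.aeval_eq_exp t hu
    obtain ⟨S, hS, h2⟩ := hh.aeval_eq_exp t hu
    refine ⟨f.leadingCoeff * R / (h.leadingCoeff * S * u), by positivity, ?_⟩
    rw [h1, h2, hd]
    have : Complex.exp (-(rootPhase f t u : ℝ) * Complex.I) =
        Complex.exp (-(rootPhase h t u : ℝ) * Complex.I) *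
        Complex.exp ((-(rootPhase f t u - rootPhase h t u) : ℝ) * Complex.I) := by
      rw [← Complex.exp_add]
      congr 1
      push_cast
      ring
    rw [this]
    have e1 : (u : ℂ) ≠ 0 := by exact_mod_cast hu.ne'
    have e2 : (S : ℂ) ≠ 0 := by exact_mod_cast hS.ne'
    have e3 : (h.leadingCoeff : ℂ) ≠ 0 := by exact_mod_cast hhl.ne'
    push_cast
    rw [pow_succ]
    field_simp
  have him : ∀ ρ Φ : ℝ, (Complex.I * ρ * Complex.exp ((-Φ : ℝ) * Complex.I)).im =
      ρ * Real.cos Φ := by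
    intro ρ Φ
    rw [Complex.exp_mul_I, ← Complex.ofReal_cos, ← Complex.ofReal_sin, Real.cos_neg]
    simp [-Complex.ofReal_cos, -Complex.ofReal_sin]
  constructor
  · intro H t u hu
    by_contra! hc
    obtain ⟨ρ, hρ, e⟩ := key t u hu
    refine H ((t : ℂ) + Complex.I / u)
      (-(Complex.I * ρ * Complex.exp ((-(rootPhase f t u - rootPhase h t u) : ℝ) * Complex.I)))
      ?_ ?_ ?_
    · simpa using hu
    · rw [Complex.neg_im, him]
      nlinarith
    · rw [e]
      ring
  · intro H z s hz hs e
    have hzeq : z = (z.re : ℂ) + Complex.I / ((z.im)⁻¹ : ℝ) := by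
      apply Complex.ext <;> simp
    have hu : 0 < (z.im)⁻¹ := by positivity
    obtain ⟨ρ, hρ, e'⟩ := key z.re _ hu
    rw [← hzeq] at e'
    rw [e', mul_comm, ← add_mul] at e
    have := (mul_eq_zero.1 e).resolve_right (hh.aeval_ne_zero hz)
    have h3 := congrArg Complex.im this
    rw [Complex.add_im, him, Complex.zero_im] at h3
    have := mul_nonneg hρ.le (H z.re _ hu)
    linarith

theorem Interlaces.nonvanishingPencil {h f : ℝ[X]} (H : Interlaces h f)
    (hfl : 0 < f.leadingCoeff) (hhl : 0 < h.leadingCoeff) : NonvanishingPencil h f := by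
  obtain ⟨hf, hh, hd, hi⟩ := H
  rw [nonvanishingPencil_iff hf hh hd hfl hhl]
  intro t u hu
  have mono : ∀ {a b : ℝ}, a ≤ b → Real.arctan ((t - b) * u) ≤ Real.arctan ((t - a) * u) := by
    intro a b hab
    exact Real.arctan_mono (by gcongr)
  apply Real.cos_nonneg_of_neg_pi_div_two_le_of_le
  · rw [rootPhase, rootPhase, hd, Finset.sum_range_succ]
    have := Finset.sum_le_sum fun i hi' => mono (hi i (Finset.mem_range.1 hi')).1
    have := Real.neg_pi_div_two_lt_arctan ((t - (sortedRoots f).getD h.natDegree 0) * u)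
    linarith
  · rw [rootPhase, rootPhase, hd, Finset.sum_range_succ']
    have := Finset.sum_le_sum fun i hi' => mono (hi i (Finset.mem_range.1 hi')).2
    have := Real.arctan_lt_pi_div_two ((t - (sortedRoots f).getD 0 0) * u)
    linarith

theorem NonvanishingPencil.abs_rootPhase_sub_le {h f : ℝ[X]} (H : NonvanishingPencil h f)
    (hf : RealRooted f) (hh : RealRooted h) (hd : f.natDegree = h.natDegree + 1)
    (hfl : 0 < f.leadingCoeff) (hhl : 0 < h.leadingCoeff) (t : ℝ) {u : ℝ} (hu : 0 < u) :
    |rootPhase f t u - rootPhase h t u| ≤ Real.pi / 2 := by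
  rw [nonvanishingPencil_iff hf hh hd hfl hhl] at H
  set Φ : ℝ → ℝ := fun u => |rootPhase f t u - rootPhase h t u| with hΦ
  have hcos : ∀ u, 0 < u → 0 ≤ Real.cos (Φ u) := fun u hu => by
    rw [hΦ, Real.cos_abs]
    exact H t u hu
  have hcont : Continuous Φ := by
    simp only [hΦ, rootPhase]
    fun_prop
  have h0 : Φ 0 = 0 := by simp [hΦ, rootPhase]
  by_contra! hlt
  change Real.pi / 2 < Φ u at hlt
  have hpi := Real.pi_pos
  set c := min (Φ u) Real.pi
  have hc1 : Real.pi / 2 < c := lt_min hlt (by linarith)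
  obtain ⟨v, hv, hvc⟩ := intermediate_value_Icc hu.le hcont.continuousOn
    (show c ∈ Set.Icc (Φ 0) (Φ u) from ⟨by rw [h0]; linarith, min_le_left _ _⟩)
  have hv0 : v ≠ 0 := by
    rintro rfl
    linarith
  have := hcos v (lt_of_le_of_ne hv.1 hv0.symm)
  rw [hvc] at this
  have : Real.cos c < 0 := Real.cos_neg_of_pi_div_two_lt_of_lt hc1
    (by have : c ≤ Real.pi := min_le_right _ _
        linarith)
  linarith

theorem tendsto_arctan_mul_atTop (c : ℝ) :
    Filter.Tendsto (fun u => Real.arctan (c * u)) Filter.atTop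
      (nhds (Real.pi / 2 * (SignType.sign c : ℝ))) := by
  rcases lt_trichotomy c 0 with h | h | h
  · have : Filter.Tendsto (fun u => c * u) Filter.atTop Filter.atBot :=
      Filter.tendsto_id.const_mul_atTop_of_neg h
    simpa [sign_neg h, Function.comp_def] using
      (Real.tendsto_arctan_atBot.mono_right nhdsWithin_le_nhds).comp this
  · simp [h]
  · have : Filter.Tendsto (fun u => c * u) Filter.atTop Filter.atTop :=
      Filter.tendsto_id.const_mul_atTop h
    simpa [sign_pos h, Function.comp_def] using
      (Real.tendsto_arctan_atTop.mono_right nhdsWithin_le_nhds).comp this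

theorem NonvanishingPencil.abs_sum_sign_sub_le {h f : ℝ[X]} (H : NonvanishingPencil h f)
    (hf : RealRooted f) (hh : RealRooted h) (hd : f.natDegree = h.natDegree + 1)
    (hfl : 0 < f.leadingCoeff) (hhl : 0 < h.leadingCoeff) (t : ℝ) :
    |∑ i ∈ Finset.range f.natDegree, (SignType.sign (t - (sortedRoots f).getD i 0) : ℝ) -
      ∑ i ∈ Finset.range h.natDegree, (SignType.sign (t - (sortedRoots h).getD i 0) : ℝ)| ≤ 1 := by
  have lim : ∀ p : ℝ[X], Filter.Tendsto (fun u => rootPhase p t u) Filter.atTop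
      (nhds (∑ i ∈ Finset.range p.natDegree,
        Real.pi / 2 * (SignType.sign (t - (sortedRoots p).getD i 0) : ℝ))) := fun p =>
    tendsto_finsetSum _ fun i _ => tendsto_arctan_mul_atTop _
  have := le_of_tendsto ((lim f).sub (lim h)).abs (Filter.eventually_atTop.2
    ⟨1, fun u hu => H.abs_rootPhase_sub_le hf hh hd hfl hhl t (by linarith : (0 : ℝ) < u)⟩)
  rw [← Finset.mul_sum, ← Finset.mul_sum, ← mul_sub, abs_mul, abs_of_pos (by positivity)] at this
  have hpi : 0 < Real.pi / 2 := by positivity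
  nlinarith

theorem sum_range_sign_bounds (n k : ℕ) (hk : k ≤ n) (a : ℕ → ℝ) (t : ℝ) :
    ((∀ i, k ≤ i → i < n → t < a i) →
      ∑ i ∈ Finset.range n, (SignType.sign (t - a i) : ℝ) ≤ 2 * k - n) ∧
    ((∀ i, i < k → a i < t) →
      (2 * k - n : ℝ) ≤ ∑ i ∈ Finset.range n, (SignType.sign (t - a i) : ℝ)) := by
  have bound : ∀ x : ℝ, -1 ≤ (SignType.sign x : ℝ) ∧ (SignType.sign x : ℝ) ≤ 1 := by
    intro x
    rcases lt_trichotomy x 0 with h | h | h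
    · simp [sign_neg h]
    · simp [h]
    · simp [sign_pos h]
  obtain ⟨m, rfl⟩ := Nat.exists_eq_add_of_le hk
  rw [Finset.sum_range_add]
  constructor <;> intro H
  · have h1 := Finset.sum_le_card_nsmul (Finset.range k) _ 1 fun i _ => (bound (t - a i)).2
    have h2 : ∑ i ∈ Finset.range m, (SignType.sign (t - a (k + i)) : ℝ) =
        ∑ i ∈ Finset.range m, (-1 : ℝ) := Finset.sum_congr rfl fun i hi => by
      rw [sign_neg (by have := H (k + i) (by omega) (by simpa using hi); linarith)]
      simp
    rw [h2]
    simp at h1 ⊢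
    linarith
  · have h1 := Finset.card_nsmul_le_sum (Finset.range m) _ (-1) fun i _ => (bound (t - a (k + i))).1
    have h2 : ∑ i ∈ Finset.range k, (SignType.sign (t - a i) : ℝ) =
        ∑ i ∈ Finset.range k, (1 : ℝ) := Finset.sum_congr rfl fun i hi => by
      rw [sign_pos (by have := H i (by simpa using hi); linarith)]
      simp
    rw [h2]
    simp at h1 ⊢
    linarith

theorem NonvanishingPencil.interlaces {h f : ℝ[X]} (H : NonvanishingPencil h f)
    (hf : RealRooted f) (hh : RealRooted h) (hd : f.natDegree = h.natDegree + 1)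
    (hfl : 0 < f.leadingCoeff) (hhl : 0 < h.leadingCoeff) : Interlaces h f := by
  refine ⟨hf, hh, hd, fun i hi => ?_⟩
  have hlf := hf.length_sortedRoots
  have hlh := hh.length_sortedRoots
  constructor
  · by_contra! hlt
    obtain ⟨t, ht1, ht2⟩ := exists_between hlt
    have h1 := (sum_range_sign_bounds f.natDegree i (by omega)
      (fun i => (sortedRoots f).getD i 0) t).1 fun j hj hj' =>
        ht2.trans_le (sortedRoots_getD_mono hj (by omega))
    have h2 := (sum_range_sign_bounds h.natDegree (i + 1) (by omega)
      (fun i => (sortedRoots h).getD i 0) t).2 fun j hj =>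
        (sortedRoots_getD_mono (by omega) (by omega)).trans_lt ht1
    have h3 := (abs_le.1 (H.abs_sum_sign_sub_le hf hh hd hfl hhl t)).1
    have h4 : (f.natDegree : ℝ) = h.natDegree + 1 := by exact_mod_cast hd
    push_cast at h2
    linarith
  · by_contra! hlt
    obtain ⟨t, ht1, ht2⟩ := exists_between hlt
    have h1 := (sum_range_sign_bounds f.natDegree (i + 2) (by omega)
      (fun i => (sortedRoots f).getD i 0) t).2 fun j hj =>
        (sortedRoots_getD_mono (by omega) (by omega)).trans_lt ht1
    have h2 := (sum_range_sign_bounds h.natDegree i (by omega)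
      (fun i => (sortedRoots h).getD i 0) t).1 fun j hj hj' =>
        ht2.trans_le (sortedRoots_getD_mono hj (by omega))
    have h3 := (abs_le.1 (H.abs_sum_sign_sub_le hf hh hd hfl hhl t)).2
    have h4 : (f.natDegree : ℝ) = h.natDegree + 1 := by exact_mod_cast hd
    push_cast at h1
    linarith

theorem Interlaces.mul_right {h f g : ℝ[X]} (H : Interlaces h f) (hg : RealRooted g)
    (hfl : 0 < f.leadingCoeff) (hhl : 0 < h.leadingCoeff) (hgl : 0 < g.leadingCoeff) :
    Interlaces (h * g) (f * g) := by
  have hpencil := H.nonvanishingPencil hfl hhl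
  obtain ⟨hf, hh, hd, -⟩ := H
  refine NonvanishingPencil.interlaces (fun z s hz hs => ?_) (hf.mul hg) (hh.mul hg) ?_ ?_ ?_
  · rw [map_mul, map_mul, ← mul_assoc, ← add_mul]
    exact mul_ne_zero (hpencil z s hz hs) (hg.aeval_ne_zero hz)
  · rw [natDegree_mul hf.1 hg.1, natDegree_mul hh.1 hg.1, hd]
    ring
  · rw [leadingCoeff_mul]
    positivity
  · rw [leadingCoeff_mul]
    positivity

theorem interlaces_X_add_C_mul {g : ℝ[X]} (hg : RealRooted g) (hgl : 0 < g.leadingCoeff) (a : ℝ) :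
    Interlaces g ((X + C a) * g) := by
  have ha : RealRooted (X + C a) := realRooted_of_aeval_ne_zero fun z hz h => by
    have := congrArg Complex.im h
    simp at this
    exact hz.ne' this
  refine NonvanishingPencil.interlaces (fun z s hz hs => ?_) (ha.mul hg) hg ?_ ?_ hgl
  · rw [map_mul, ← add_mul]
    refine mul_ne_zero (fun h => ?_) (hg.aeval_ne_zero hz)
    have := congrArg Complex.im h
    simp at this
    linarith
  · rw [natDegree_mul ha.1 hg.1, natDegree_X_add_C, add_comm]
  · rwa [leadingCoeff_mul, leadingCoeff_X_add_C, one_mul]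

/-! ### The diamond product -/

/-- The truncation at `k < N` of the diamond product
`∑ₖ (f⁽ᵏ⁾ / k!) (g⁽ᵏ⁾ / k!) (x (x + 1))ᵏ`. -/
noncomputable def diamond {R : Type*} [CommSemiring R] (N : ℕ) (f g : R[X]) : R[X] :=
  ∑ k ∈ Finset.range N, hasseDeriv k f * hasseDeriv k g * (X * (X + 1)) ^ k

theorem diamond_comm {R : Type*} [CommSemiring R] (N : ℕ) (f g : R[X]) :
    diamond N f g = diamond N g f :=
  Finset.sum_congr rfl fun _ _ => by ring

theorem diamond_add_left {R : Type*} [CommSemiring R] (N : ℕ) (f h g : R[X]) :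
    diamond N (f + h) g = diamond N f g + diamond N h g := by
  simp only [diamond, map_add, add_mul, Finset.sum_add_distrib]

theorem diamond_smul_left {R : Type*} [CommSemiring R] (N : ℕ) (c : R) (f g : R[X]) :
    diamond N (c • f) g = c • diamond N f g := by
  simp only [diamond, map_smul, smul_mul_assoc, Finset.smul_sum]

theorem map_hasseDeriv {R S : Type*} [Semiring R] [Semiring S] (φ : R →+* S) (k : ℕ) (f : R[X]) :
    (hasseDeriv k f).map φ = hasseDeriv k (f.map φ) := by
  ext n
  simp [hasseDeriv_coeff]

theorem map_diamond {R S : Type*} [CommSemiring R] [CommSemiring S] (φ : R →+* S) (N : ℕ)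
    (f g : R[X]) : (diamond N f g).map φ = diamond N (f.map φ) (g.map φ) := by
  simp [diamond, Polynomial.map_sum, map_hasseDeriv]

/-- A complex polynomial with all zeros in the open lower half plane has no vanishing
coefficient up to its degree. -/
theorem coeff_ne_zero_of_roots_im_neg (k : ℕ) {P : ℂ[X]} (hP : P ≠ 0)
    (hroots : ∀ z, P.IsRoot z → z.im < 0) (hk : k ≤ P.natDegree) : P.coeff k ≠ 0 := by
  induction k generalizing P with
  | zero =>
    intro h
    rw [coeff_zero_eq_eval_zero] at h
    simpa using hroots 0 h
  | succ k ih =>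
    have hdeg : 0 < P.natDegree := by omega
    have hd : P.derivative ≠ 0 := by
      intro h
      have := derivative_eq_zero.1 h
      omega
    have := ih hd (fun z hz => ?_) (by rw [natDegree_derivative]; omega)
    · rw [coeff_derivative] at this
      exact left_ne_zero_of_mul this
    · have hmem : z ∈ P.derivative.rootSet ℂ := by
        rw [mem_rootSet]
        exact ⟨hd, by simpa using hz⟩
      have hconv : Convex ℝ {w : ℂ | w.im < 0} := convex_halfSpace_im_lt 0
      refine convexHull_min (fun w hw => ?_) hconv
        (rootSet_derivative_subset_convexHull_rootSet (natDegree_pos_iff_degree_pos.1 hdeg) hmem)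
      rw [mem_rootSet] at hw
      exact hroots w (by simpa using hw.2)

theorem im_neg_of_add_div_eq {x y : ℂ} {b : ℝ} (hb : b ∈ Set.Icc (-1 : ℝ) 0) (hx : 0 < x.im)
    (hy : y ≠ 0) (h : x + x * (x + 1) / y = b) : y.im < 0 := by
  have hx0 : x ≠ 0 := by
    rintro rfl
    simp at hx
  have hx1 : x + 1 ≠ 0 := by
    intro h
    have := congrArg Complex.im h
    simp at this
    exact hx.ne' this
  have hinv : ∀ w : ℂ, 0 < w.im → (w⁻¹).im < 0 := by
    intro w hw
    have : w ≠ 0 := by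
      rintro rfl
      simp at hw
    rw [Complex.inv_im]
    have := Complex.normSq_pos.2 this
    exact div_neg_of_neg_of_pos (by linarith) this
  have key : y⁻¹ = ((-(-b) : ℝ) : ℂ) * x⁻¹ + ((-(1 + b) : ℝ) : ℂ) * (x + 1)⁻¹ := by
    field_simp at h ⊢
    push_cast
    linear_combination h
  have h1 := hinv x hx
  have h2 := hinv (x + 1) (by simpa using hx)
  have h3 : 0 < (y⁻¹).im := by
    rw [key, Complex.add_im, Complex.im_ofReal_mul, Complex.im_ofReal_mul]
    obtain ⟨hb1, hb2⟩ := hb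
    rcases hb2.lt_or_eq with hb2 | rfl
    · nlinarith
    · linarith
  have := hinv _ h3
  rwa [inv_inv] at this

theorem eval_diamond_ne_zero {N : ℕ} {F g : ℂ[X]} {x : ℂ} (hF : ∀ z : ℂ, 0 < z.im → F.eval z ≠ 0)
    (hg0 : g ≠ 0) (hg : ∀ z, g.IsRoot z → ∃ b : ℝ, b ∈ Set.Icc (-1 : ℝ) 0 ∧ z = b)
    (hx : 0 < x.im) (hN : g.natDegree < N) : (diamond N F g).eval x ≠ 0 := by
  have hF0 : F ≠ 0 := by
    rintro rfl
    exact hF x hx (by simp)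
  have hgim : ∀ z : ℂ, 0 < z.im → g.eval z ≠ 0 := by
    intro z hz h
    obtain ⟨b, -, rfl⟩ := hg z h
    simp at hz
  have hx0 : x ≠ 0 := by
    rintro rfl
    simp at hx
  have hx1 : x + 1 ≠ 0 := by
    intro h
    have := congrArg Complex.im h
    simp at this
    exact hx.ne' this
  set w := x * (x + 1) with hw
  have hw0 : w ≠ 0 := mul_ne_zero hx0 hx1
  set n := g.natDegree with hn
  set q : ℂ[X] := (taylor x g).comp (C w * X) with hq
  have hqc : ∀ k, q.coeff k = (hasseDeriv k g).eval x * w ^ k := fun k => by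
    rw [hq, comp_C_mul_X_coeff, taylor_coeff]
  have hqd : q.natDegree ≤ n := by
    rw [hq, natDegree_comp, natDegree_taylor, natDegree_C_mul_X _ hw0, mul_one]
  have hqe : ∀ y, q.eval y = g.eval (x + w * y) := fun y => by
    rw [hq, eval_comp, taylor_eval]
    simp [add_comm]
  set G : ℂ[X] := reflect n q with hG
  have hGc : ∀ k, k ≤ n → G.coeff k = q.coeff (n - k) := fun k hk => by
    rw [hG, coeff_reflect, revAt_le hk]
  have hGn : G.coeff n ≠ 0 := by
    rw [hGc n le_rfl, Nat.sub_self, hqc]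
    simpa using hgim x hx
  have hG0 : G ≠ 0 := by
    intro h
    simp [h] at hGn
  have hGroot : ∀ y, G.IsRoot y → y.im < 0 := by
    intro y hy
    have hy0 : y ≠ 0 := by
      rintro rfl
      rw [IsRoot, ← coeff_zero_eq_eval_zero, hGc 0 (Nat.zero_le _), Nat.sub_zero, hqc,
        ← taylor_coeff, hn, coeff_taylor_natDegree] at hy
      exact mul_ne_zero (leadingCoeff_ne_zero.2 hg0) (pow_ne_zero _ hw0) hy
    let _ : Invertible y⁻¹ := invertibleOfNonzero (inv_ne_zero hy0)
    have hq0 : q.eval y⁻¹ = 0 := by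
      have := (eval₂_reflect_eq_zero_iff (RingHom.id ℂ) y⁻¹ n q hqd).1
        (by simpa [eval₂_id] using hy)
      simpa [eval₂_id] using this
    rw [hqe] at hq0
    obtain ⟨b, hb, hb'⟩ := hg _ hq0
    exact im_neg_of_add_div_eq hb hx hy0 (by rw [← hb', div_eq_mul_inv])
  have hT0 : taylor x F ≠ 0 := fun h => hF0 ((taylor_eq_zero _ _).1 h)
  have hroot : ∀ y, (taylor x F * G).IsRoot y → y.im < 0 := by
    intro y hy
    rw [IsRoot, eval_mul, mul_eq_zero] at hy
    rcases hy with hy | hy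
    · rw [taylor_eval] at hy
      by_contra! h
      exact hF (y + x) (by simp; linarith) hy
    · exact hGroot y hy
  have hcoeff := coeff_ne_zero_of_roots_im_neg n (mul_ne_zero hT0 hG0) hroot (by
    rw [natDegree_mul hT0 hG0]
    have := le_natDegree_of_ne_zero hGn
    omega)
  convert hcoeff using 1
  rw [coeff_mul, Finset.Nat.sum_antidiagonal_eq_sum_range_succ
    (fun i j => (taylor x F).coeff i * G.coeff j), diamond, eval_finsetSum]
  symm
  refine Finset.sum_subset_zero_on_sdiff (Finset.range_mono (by omega)) ?_ ?_
  · intro k hk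
    simp only [Finset.mem_sdiff, Finset.mem_range] at hk
    rw [hasseDeriv_eq_zero_of_lt_natDegree g k (by omega)]
    simp
  · intro k hk
    rw [Finset.mem_range] at hk
    rw [hGc _ (by omega), Nat.sub_sub_self (by omega), hqc, taylor_coeff, hw]
    simp
    ring

theorem aeval_diamond_add_ne_zero {N : ℕ} {f h g : ℝ[X]} {s z : ℂ}
    (hF : ∀ z : ℂ, 0 < z.im → aeval z f + s * aeval z h ≠ 0) (hg : RealRooted g)
    (hroots : ∀ b, g.IsRoot b → b ∈ Set.Icc (-1 : ℝ) 0) (hz : 0 < z.im) (hN : g.natDegree < N) :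
    aeval z (diamond N f g) + s * aeval z (diamond N h g) ≠ 0 := by
  have := eval_diamond_ne_zero (N := N) (x := z)
    (F := f.map (algebraMap ℝ ℂ) + s • h.map (algebraMap ℝ ℂ)) (g := g.map (algebraMap ℝ ℂ))
    (fun w hw => by simpa [eval_map_algebraMap] using hF w hw)
    (by simpa using hg.1) (fun w hw => ?_) hz (by simpa using hN)
  · rw [diamond_add_left, diamond_smul_left, ← map_diamond, ← map_diamond] at this
    simpa [eval_map_algebraMap] using this
  · have hre : w = (w.re : ℂ) := by
      apply Complex.ext <;> simp [hg.2 w hw]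
    refine ⟨w.re, hroots _ ?_, hre⟩
    rw [hre, IsRoot, eval_map_algebraMap] at hw
    have : (algebraMap ℝ ℂ) (g.eval w.re) = 0 := by
      rw [← hw]
      exact (aeval_algebraMap_apply_eq_algebraMap_eval w.re g).symm
    simpa using this

theorem RealRooted.diamond {N : ℕ} {f g : ℝ[X]} (hf : RealRooted f) (hg : RealRooted g)
    (hroots : ∀ b, g.IsRoot b → b ∈ Set.Icc (-1 : ℝ) 0) (hN : g.natDegree < N) :
    RealRooted (diamond N f g) :=
  realRooted_of_aeval_ne_zero fun z hz => by
    simpa using aeval_diamond_add_ne_zero (s := 0) (h := 0)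
      (fun w hw => by simpa using hf.aeval_ne_zero hw) hg hroots hz hN

theorem coeff_diamond_pos {N : ℕ} {f g : ℝ[X]} (hf : 0 < f.leadingCoeff)
    (hg : 0 < g.leadingCoeff) (hN : g.natDegree < N) :
    0 < (diamond N f g).coeff (f.natDegree + g.natDegree) ∧
      (diamond N f g).natDegree ≤ f.natDegree + g.natDegree := by
  have term : ∀ k, (hasseDeriv k f * hasseDeriv k g * (X * (X + 1)) ^ k).natDegree ≤
      f.natDegree + g.natDegree ∧
      (hasseDeriv k f * hasseDeriv k g * (X * (X + 1)) ^ k).coeff (f.natDegree + g.natDegree) =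
        f.natDegree.choose k * g.natDegree.choose k * (f.leadingCoeff * g.leadingCoeff) := by
    intro k
    by_cases hk : k ≤ f.natDegree ∧ k ≤ g.natDegree
    · obtain ⟨⟨m, hm⟩, n, hn⟩ := hk.imp Nat.exists_eq_add_of_le Nat.exists_eq_add_of_le
      have d1 : (hasseDeriv k f).natDegree ≤ m := (natDegree_hasseDeriv_le f k).trans (by omega)
      have d2 : (hasseDeriv k g).natDegree ≤ n := (natDegree_hasseDeriv_le g k).trans (by omega)
      have d0 : (X * (X + 1) : ℝ[X]).natDegree = 2 := by compute_degree!
      have dmonic : (X * (X + 1) : ℝ[X]).Monic := by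
        exact monic_X.mul (by simpa using monic_X_add_C (1 : ℝ))
      have d3 : ((X * (X + 1) : ℝ[X]) ^ k).natDegree = 2 * k := by
        rw [natDegree_pow, d0]
        ring
      have e3 : ((X * (X + 1) : ℝ[X]) ^ k).coeff (2 * k) = 1 := by
        rw [← d3]
        exact (dmonic.pow k).coeff_natDegree
      have d12 := natDegree_mul_le_of_le d1 d2
      have e : f.natDegree + g.natDegree = m + n + 2 * k := by omega
      rw [e]
      refine ⟨natDegree_mul_le_of_le d12 d3.le, ?_⟩
      rw [coeff_mul_add_eq_of_natDegree_le d12 d3.le, coeff_mul_add_eq_of_natDegree_le d1 d2, e3,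
        hasseDeriv_coeff, hasseDeriv_coeff, leadingCoeff, leadingCoeff, hm, hn, add_comm m k,
        add_comm n k]
      ring
    · rw [not_and_or, not_le, not_le] at hk
      rcases hk with hk | hk <;>
        simp [hasseDeriv_eq_zero_of_lt_natDegree _ _ hk, Nat.choose_eq_zero_of_lt hk]
  constructor
  · rw [_root_.diamond, finsetSum_coeff, Finset.sum_congr rfl fun k _ => (term k).2]
    refine Finset.sum_pos' (fun k _ => by positivity) ⟨0, ?_, by simp; positivity⟩
    simp
    omega
  · exact natDegree_sum_le_of_forall_le _ _ fun k _ => (term k).1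

theorem natDegree_diamond {N : ℕ} {f g : ℝ[X]} (hf : 0 < f.leadingCoeff)
    (hg : 0 < g.leadingCoeff) (hN : g.natDegree < N) :
    (diamond N f g).natDegree = f.natDegree + g.natDegree :=
  (coeff_diamond_pos hf hg hN).2.antisymm
    (le_natDegree_of_ne_zero (coeff_diamond_pos hf hg hN).1.ne')

theorem leadingCoeff_diamond_pos {N : ℕ} {f g : ℝ[X]} (hf : 0 < f.leadingCoeff)
    (hg : 0 < g.leadingCoeff) (hN : g.natDegree < N) : 0 < (diamond N f g).leadingCoeff := by
  rw [leadingCoeff, natDegree_diamond hf hg hN]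
  exact (coeff_diamond_pos hf hg hN).1

theorem Interlaces.diamond_right {N : ℕ} {h f g : ℝ[X]} (H : Interlaces h f) (hg : RealRooted g)
    (hroots : ∀ b, g.IsRoot b → b ∈ Set.Icc (-1 : ℝ) 0) (hfl : 0 < f.leadingCoeff)
    (hhl : 0 < h.leadingCoeff) (hgl : 0 < g.leadingCoeff) (hN : g.natDegree < N) :
    Interlaces (diamond N h g) (diamond N f g) := by
  have hpencil := H.nonvanishingPencil hfl hhl
  obtain ⟨hf, hh, hd, -⟩ := H
  refine NonvanishingPencil.interlaces (fun z s hz hs => ?_) (hf.diamond hg hroots hN)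
    (hh.diamond hg hroots hN) ?_ (leadingCoeff_diamond_pos hfl hgl hN)
    (leadingCoeff_diamond_pos hhl hgl hN)
  · exact aeval_diamond_add_ne_zero (fun w hw => hpencil w s hw hs) hg hroots hz hN
  · rw [natDegree_diamond hfl hgl hN, natDegree_diamond hhl hgl hN, hd]
    ring

/-! ### The diamond product and binomial coefficients -/

/-- The linear functional sending `X ^ k` to `m.choose k`. -/
noncomputable def chooseFunctional (m : ℕ) (f : ℝ[X]) : ℝ := (f * (1 + X) ^ m).coeff m

theorem chooseFunctional_X_pow_mul (m i j : ℕ) :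
    chooseFunctional m (X ^ i * (1 + X) ^ j) = (m + j).choose (i + j) := by
  rw [chooseFunctional, mul_assoc, ← pow_add, coeff_X_pow_mul']
  split_ifs with h
  · rw [coeff_one_add_X_pow, add_comm j m,
      Nat.choose_symm_of_eq_add (show m + j = m - i + (i + j) by omega)]
  · rw [Nat.choose_eq_zero_of_lt (by omega), Nat.cast_zero]

theorem chooseFunctional_sum {ι : Type*} (m : ℕ) (s : Finset ι) (f : ι → ℝ[X]) :
    chooseFunctional m (∑ i ∈ s, f i) = ∑ i ∈ s, chooseFunctional m (f i) := by
  simp [chooseFunctional, Finset.sum_mul]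

theorem chooseFunctional_smul (m : ℕ) (c : ℝ) (f : ℝ[X]) :
    chooseFunctional m (c • f) = c * chooseFunctional m f := by
  simp [chooseFunctional]

theorem eq_of_chooseFunctional_eq {f g : ℝ[X]}
    (h : ∀ m, chooseFunctional m f = chooseFunctional m g) : f = g := by
  ext n
  induction n using Nat.strong_induction_on with
  | _ n ih =>
    have := h n
    rw [chooseFunctional, chooseFunctional, coeff_mul, coeff_mul,
      Finset.Nat.sum_antidiagonal_eq_sum_range_succ (fun i j => f.coeff i * ((1 + X) ^ n).coeff j),
      Finset.Nat.sum_antidiagonal_eq_sum_range_succ (fun i j => g.coeff i * ((1 + X) ^ n).coeff j),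
      Finset.sum_range_succ, Finset.sum_range_succ,
      Finset.sum_congr rfl fun i hi => by rw [ih i (Finset.mem_range.1 hi)]] at this
    simpa [coeff_one_add_X_pow] using this

theorem sum_choose_mul_choose {N i : ℕ} (j : ℕ) (hi : i < N) :
    ∑ k ∈ Finset.range N, i.choose k * j.choose k = (i + j).choose i := by
  rw [add_comm, Nat.add_choose_eq, Finset.Nat.sum_antidiagonal_eq_sum_range_succ
    (fun a b => j.choose a * i.choose b)]
  symm
  refine Finset.sum_subset_zero_on_sdiff (Finset.range_mono (by omega)) (fun k hk => ?_)
    fun k hk => ?_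
  · simp only [Finset.mem_sdiff, Finset.mem_range] at hk
    rw [Nat.choose_eq_zero_of_lt (by omega), zero_mul]
  · rw [Finset.mem_range] at hk
    rw [Nat.choose_symm (by omega), mul_comm]

theorem hasseDeriv_one_add_X_pow (k j : ℕ) :
    hasseDeriv k ((1 + X : ℝ[X]) ^ j) = (j.choose k : ℝ) • (1 + X) ^ (j - k) := by
  ext n
  have := Nat.choose_mul (n := j) (k := n + k) (s := k) (by omega)
  rw [Nat.add_sub_cancel, mul_comm] at this
  rw [hasseDeriv_coeff, coeff_smul, coeff_one_add_X_pow, coeff_one_add_X_pow, smul_eq_mul]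
  exact_mod_cast this

theorem diamond_X_pow {N i : ℕ} (j : ℕ) (hi : i < N) :
    diamond N (X ^ i) ((1 + X : ℝ[X]) ^ j) = ((i + j).choose i : ℝ) • (X ^ i * (1 + X) ^ j) := by
  rw [diamond, ← sum_choose_mul_choose j hi, Nat.cast_sum, Finset.sum_smul]
  refine Finset.sum_congr rfl fun k _ => ?_
  rw [hasseDeriv_one_add_X_pow, ← monomial_one_right_eq_X_pow, hasseDeriv_monomial]
  by_cases hk : k ≤ i ∧ k ≤ j
  · obtain ⟨⟨a, rfl⟩, b, rfl⟩ := hk.imp Nat.exists_eq_add_of_le Nat.exists_eq_add_of_le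
    rw [← C_mul_X_pow_eq_monomial, ← C_mul_X_pow_eq_monomial]
    simp only [Nat.add_sub_cancel_left, smul_eq_C_mul, mul_pow]
    simp
    ring
  · rw [not_and_or, not_le, not_le] at hk
    rcases hk with hk | hk <;> simp [Nat.choose_eq_zero_of_lt hk]

theorem chooseFunctional_diamond_X_pow {N i : ℕ} (m j : ℕ) (hi : i < N) :
    chooseFunctional m (diamond N (X ^ i) ((1 + X) ^ j)) =
      chooseFunctional m (X ^ i) * chooseFunctional m ((1 + X) ^ j) := by
  have h1 := chooseFunctional_X_pow_mul m i 0
  have h2 := chooseFunctional_X_pow_mul m 0 j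
  simp only [pow_zero, mul_one, one_mul, add_zero, zero_add] at h1 h2
  rw [diamond_X_pow j hi, chooseFunctional_smul, chooseFunctional_X_pow_mul, h1, h2]
  have := Nat.choose_mul (n := m + j) (k := i + j) (s := j) (by omega)
  rw [Nat.add_sub_cancel, Nat.add_sub_cancel] at this
  rw [Nat.choose_symm_add]
  norm_cast
  linarith

theorem chooseFunctional_diamond {N : ℕ} (m : ℕ) {f : ℝ[X]} (g : ℝ[X]) (hf : f.natDegree < N) :
    chooseFunctional m (diamond N f g) = chooseFunctional m f * chooseFunctional m g := by
  have hg : g = ∑ j ∈ Finset.range (g.natDegree + 1), (taylor (-1) g).coeff j • (1 + X) ^ j := by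
    have h : g = (taylor (-1) g).comp (X + C 1) := by
      rw [← taylor_apply, taylor_taylor]
      simp
    conv_lhs => rw [h, comp_eq_sum_left, sum_over_range _ (by simp), natDegree_taylor]
    simp [smul_eq_C_mul, add_comm]
  have hf' := f.as_sum_range_C_mul_X_pow
  have sum_left : ∀ (s : Finset ℕ) (c : ℕ → ℝ) (p : ℕ → ℝ[X]) (q : ℝ[X]),
      diamond N (∑ i ∈ s, c i • p i) q = ∑ i ∈ s, c i • diamond N (p i) q := by
    intro s c p q
    simp only [diamond, map_sum, map_smul, Finset.sum_mul, smul_mul_assoc, Finset.smul_sum]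
    exact Finset.sum_comm
  have key : ∀ i, i < N → chooseFunctional m (diamond N (X ^ i) g) =
      chooseFunctional m (X ^ i) * chooseFunctional m g := by
    intro i hi
    rw [hg, diamond_comm, sum_left, chooseFunctional_sum, chooseFunctional_sum, Finset.mul_sum]
    refine Finset.sum_congr rfl fun j _ => ?_
    rw [chooseFunctional_smul, chooseFunctional_smul, diamond_comm,
      chooseFunctional_diamond_X_pow m j hi]
    ring
  simp only [← smul_eq_C_mul] at hf'
  rw [hf', sum_left, chooseFunctional_sum, chooseFunctional_sum, Finset.sum_mul]
  refine Finset.sum_congr rfl fun i hi => ?_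
  rw [Finset.mem_range] at hi
  rw [chooseFunctional_smul, chooseFunctional_smul, key i (by omega)]
  ring

/-! ### Counting surjections onto initial segments -/

/-- The number of maps `σ : α → ℕ` with image `{0, …, k - 1}` that satisfy `V`. -/
noncomputable def surjCount {α : Type*} (V : (α → ℕ) → Prop) (k : ℕ) : ℕ :=
  Nat.card {σ : α → ℕ // Set.range σ = Set.Iio k ∧ V σ}

/-- The generating polynomial of `surjCount V`. -/
noncomputable def countPoly {α : Type*} (V : (α → ℕ) → Prop) : ℝ[X] :=
  ∑ k ∈ Finset.range (Nat.card α + 1), C (surjCount V k : ℝ) * X ^ k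

/-- `V σ` only depends on the relative order of the values of `σ`. -/
def OrderInvariant {α : Type*} (V : (α → ℕ) → Prop) : Prop :=
  ∀ (σ : α → ℕ) (φ : ℕ → ℕ), StrictMonoOn φ (Set.range σ) → (V (φ ∘ σ) ↔ V σ)

theorem OrderInvariant.add_right_iff {α : Type*} {V : (α → ℕ) → Prop} (hV : OrderInvariant V)
    (σ : α → ℕ) (c : ℕ) : V (fun x => σ x + c) ↔ V σ :=
  hV σ (· + c) fun _ _ _ _ h => Nat.add_lt_add_right h c

theorem finite_subtype_of_forall_lt {α : Type*} [Finite α] {Q : (α → ℕ) → Prop} (m : ℕ)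
    (h : ∀ σ, Q σ → ∀ x, σ x < m) : Finite {σ // Q σ} :=
  Finite.of_injective (fun (σ : {σ // Q σ}) (x : α) => (⟨σ.1 x, h σ.1 σ.2 x⟩ : Fin m))
    fun _ _ hστ => Subtype.ext (funext fun x => congrArg Fin.val (congrFun hστ x))

theorem lt_of_range_eq_Iio {α : Type*} {σ : α → ℕ} {k : ℕ} (h : Set.range σ = Set.Iio k) (x : α) :
    σ x < k := by
  have : σ x ∈ Set.range σ := ⟨x, rfl⟩
  rwa [h] at this

theorem mem_of_range_eq_coe {α : Type*} {σ : α → ℕ} {S : Finset ℕ} (h : Set.range σ = S) (x : α) :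
    σ x ∈ S := by
  have : σ x ∈ Set.range σ := ⟨x, rfl⟩
  rwa [h] at this

theorem exists_of_range_eq_Iio {α : Type*} {σ : α → ℕ} {k : ℕ} (h : Set.range σ = Set.Iio k)
    {c : ℕ} (hc : c < k) : ∃ x, σ x = c := by
  have : c ∈ Set.Iio k := hc
  rwa [← h] at this

theorem range_eq_Iio_of {α : Type*} {σ : α → ℕ} {k : ℕ} (h1 : ∀ x, σ x < k)
    (h2 : ∀ c < k, ∃ x, σ x = c) : Set.range σ = Set.Iio k := by
  ext c
  constructor
  · rintro ⟨x, rfl⟩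
    exact h1 x
  · exact h2 c

theorem finite_surj {α : Type*} [Finite α] (V : (α → ℕ) → Prop) (k : ℕ) :
    Finite {σ : α → ℕ // Set.range σ = Set.Iio k ∧ V σ} :=
  finite_subtype_of_forall_lt k fun _ h => lt_of_range_eq_Iio h.1

theorem surjCount_eq_zero_of_card_lt {α : Type*} [Finite α] (V : (α → ℕ) → Prop) {k : ℕ}
    (hk : Nat.card α < k) : surjCount V k = 0 := by
  have : IsEmpty {σ : α → ℕ // Set.range σ = Set.Iio k ∧ V σ} := by
    refine ⟨fun σ => ?_⟩
    have h1 : (Set.range σ.1).ncard ≤ Nat.card α := by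
      rw [← Set.image_univ, ← Set.ncard_univ]
      exact Set.ncard_image_le
    rw [σ.2.1, ← Finset.coe_Iio, Set.ncard_coe_finset, Nat.card_Iio] at h1
    omega
  exact Nat.card_of_isEmpty

theorem surjCount_zero {α : Type*} [Nonempty α] (V : (α → ℕ) → Prop) : surjCount V 0 = 0 := by
  have : IsEmpty {σ : α → ℕ // Set.range σ = Set.Iio 0 ∧ V σ} :=
    ⟨fun σ => absurd (lt_of_range_eq_Iio σ.2.1 (Classical.arbitrary α)) (by omega)⟩
  exact Nat.card_of_isEmpty

theorem coeff_countPoly {α : Type*} [Finite α] (V : (α → ℕ) → Prop) (k : ℕ) :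
    (countPoly V).coeff k = surjCount V k := by
  simp only [countPoly, finsetSum_coeff, coeff_C_mul_X_pow, Finset.sum_ite_eq, Finset.mem_range]
  split_ifs with h
  · rfl
  · rw [surjCount_eq_zero_of_card_lt V (by omega), Nat.cast_zero]

theorem natDegree_countPoly_le {α : Type*} (V : (α → ℕ) → Prop) :
    (countPoly V).natDegree ≤ Nat.card α :=
  natDegree_sum_le_of_forall_le _ _ fun k hk =>
    (natDegree_C_mul_X_pow_le _ _).trans (by simpa [Nat.lt_succ_iff] using hk)

theorem countPoly_congr {α β : Type*} [Finite α] (e : α ≃ β) {V : (α → ℕ) → Prop}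
    {W : (β → ℕ) → Prop} (h : ∀ σ : β → ℕ, W σ ↔ V (σ ∘ e)) : countPoly V = countPoly W := by
  have : Finite β := Finite.of_equiv α e
  ext k
  rw [coeff_countPoly, coeff_countPoly, surjCount, surjCount]
  congr 1
  refine Nat.card_congr ((e.arrowCongr (Equiv.refl ℕ)).subtypeEquiv fun σ => ?_)
  rw [h]
  simp [Equiv.arrowCongr, Function.comp_assoc, e.symm.surjective.range_comp]

/-- Counting a type through a partition indexed by a finset. -/
theorem card_subtype_eq_sum {ι X : Type*} (s : Finset ι) {P : X → Prop} {Q : ι → X → Prop}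
    [∀ i, Finite {x // Q i x}] (h : ∀ x, P x ↔ ∃ i ∈ s, Q i x)
    (huniq : ∀ x, ∀ i ∈ s, ∀ j ∈ s, Q i x → Q j x → i = j) :
    Nat.card {x // P x} = ∑ i ∈ s, Nat.card {x // Q i x} := by
  rw [← Finset.sum_coe_sort s fun i => Nat.card {x // Q i x}, ← Nat.card_sigma]
  symm
  refine Nat.card_congr (Equiv.ofBijective
    (fun p : Σ i : s, {x // Q i x} => (⟨p.2.1, (h _).2 ⟨p.1.1, p.1.2, p.2.2⟩⟩ : {x // P x}))
    ⟨?_, ?_⟩)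
  · rintro ⟨⟨i, hi⟩, x, hx⟩ ⟨⟨j, hj⟩, y, hy⟩ hxy
    obtain rfl : x = y := congrArg Subtype.val hxy
    obtain rfl := huniq x i hi j hj hx hy
    rfl
  · rintro ⟨x, hx⟩
    obtain ⟨i, hi, hq⟩ := (h x).1 hx
    exact ⟨⟨⟨i, hi⟩, x, hq⟩, rfl⟩

/-! ### Ordinal sums -/

/-- Every value on `β` is smaller than every value on `α`. -/
def StrictSum {α β : Type*} (V : (α → ℕ) → Prop) (W : (β → ℕ) → Prop) (σ : α ⊕ β → ℕ) : Prop :=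
  V (σ ∘ Sum.inl) ∧ W (σ ∘ Sum.inr) ∧ ∀ a b, σ (Sum.inr b) < σ (Sum.inl a)

/-- Every value on `β` is at most every value on `α`. -/
def WeakSum {α β : Type*} (V : (α → ℕ) → Prop) (W : (β → ℕ) → Prop) (σ : α ⊕ β → ℕ) : Prop :=
  V (σ ∘ Sum.inl) ∧ W (σ ∘ Sum.inr) ∧ ∀ a b, σ (Sum.inr b) ≤ σ (Sum.inl a)

theorem surjCount_strictSum {α β : Type*} [Finite α] [Finite β] {V : (α → ℕ) → Prop}
    {W : (β → ℕ) → Prop} (hV : OrderInvariant V) (k : ℕ) :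
    surjCount (StrictSum V W) k =
      ∑ p ∈ Finset.HasAntidiagonal.antidiagonal k, surjCount V p.1 * surjCount W p.2 := by
  let Q : ℕ × ℕ → (α ⊕ β → ℕ) → Prop := fun p σ =>
    (∀ a, p.2 ≤ σ (Sum.inl a)) ∧
    (Set.range (fun a => σ (Sum.inl a) - p.2) = Set.Iio p.1 ∧ V (fun a => σ (Sum.inl a) - p.2)) ∧
    (Set.range (σ ∘ Sum.inr) = Set.Iio p.2 ∧ W (σ ∘ Sum.inr))
  have hQlt : ∀ p σ, Q p σ → ∀ x, σ x < p.1 + p.2 := by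
    rintro p σ ⟨h1, ⟨h2, -⟩, h3, -⟩ (a | b)
    · have := lt_of_range_eq_Iio h2 a
      have := h1 a
      omega
    · have := lt_of_range_eq_Iio h3 b
      simp only [Function.comp_apply] at this
      omega
  have hfin : ∀ p, Finite {σ // Q p σ} := fun p => finite_subtype_of_forall_lt _ (hQlt p)
  rw [surjCount, card_subtype_eq_sum (Finset.HasAntidiagonal.antidiagonal k) (Q := Q)]
  · refine Finset.sum_congr rfl fun p _ => ?_
    rw [surjCount, surjCount, ← Nat.card_prod]
    refine Nat.card_congr ⟨fun σ => (⟨_, σ.2.2.1⟩, ⟨_, σ.2.2.2⟩),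
      fun τ => ⟨Sum.elim (fun a => τ.1.1 a + p.2) τ.2.1, ?_, ?_, ?_⟩, ?_, ?_⟩
    · simp
    · simpa using τ.1.2
    · simpa using τ.2.2
    · rintro ⟨σ, hσ⟩
      ext (a | b)
      · simpa using Nat.sub_add_cancel (hσ.1 a)
      · rfl
    · rintro ⟨σ, τ⟩
      simp
  · intro σ
    constructor
    · rintro ⟨hr, hV', hW', hlt⟩
      have hfin : (Set.range (σ ∘ Sum.inr)).Finite := Set.finite_range _
      obtain ⟨j, hj⟩ : ∃ j, Set.range (σ ∘ Sum.inr) = Set.Iio j := by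
        have hlow : IsLowerSet (Set.range (σ ∘ Sum.inr)) := by
          rintro _ c hc ⟨b, rfl⟩
          simp only [Function.comp_apply] at hc
          obtain ⟨x | x, hx⟩ := exists_of_range_eq_Iio hr
            (hc.trans_lt (lt_of_range_eq_Iio hr (Sum.inr b)))
          · have := hlt x b
            omega
          · exact ⟨x, hx⟩
        rcases (IsLowerSet.eq_univ_or_Iio hlow) with h | ⟨j, h⟩
        · rw [h] at hfin
          exact absurd hfin Set.infinite_univ
        · exact ⟨j, h⟩
      have hjk : j ≤ k := by
        by_contra! h
        obtain ⟨b, hb⟩ := exists_of_range_eq_Iio hj h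
        have := lt_of_range_eq_Iio hr (Sum.inr b)
        simp only [Function.comp_apply] at hb
        omega
      have hja : ∀ a, j ≤ σ (Sum.inl a) := by
        intro a
        by_contra! h
        obtain ⟨b, hb⟩ := exists_of_range_eq_Iio hj h
        have := hlt a b
        simp only [Function.comp_apply] at hb
        omega
      refine ⟨(k - j, j), by simp; omega, hja, ⟨range_eq_Iio_of ?_ ?_, ?_⟩, hj, hW'⟩
      · intro a
        have := lt_of_range_eq_Iio hr (Sum.inl a)
        have := hja a
        simp only
        omega
      · intro c hc
        simp only at hc
        obtain ⟨x | x, hx⟩ := exists_of_range_eq_Iio hr (show c + j < k by omega)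
        · exact ⟨x, by simp [hx]⟩
        · have := lt_of_range_eq_Iio hj x
          simp only [Function.comp_apply] at this
          omega
      · rw [← hV.add_right_iff _ j]
        simpa [Function.comp_def, Nat.sub_add_cancel (hja _)] using hV'
    · rintro ⟨⟨i, j⟩, hij, hQ⟩
      have hlt := hQlt _ _ hQ
      obtain ⟨h1, ⟨h2, h3⟩, h4, h5⟩ := hQ
      simp only [Finset.HasAntidiagonal.mem_antidiagonal] at hij hlt h1 h2 h3 h4
      subst hij
      refine ⟨range_eq_Iio_of hlt fun c hc => ?_, ?_, h5, fun a b => ?_⟩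
      · by_cases hcj : c < j
        · obtain ⟨b, hb⟩ := exists_of_range_eq_Iio h4 hcj
          exact ⟨Sum.inr b, hb⟩
        · obtain ⟨a, ha⟩ := exists_of_range_eq_Iio h2 (show c - j < i by omega)
          have := h1 a
          exact ⟨Sum.inl a, by omega⟩
      · rw [← hV.add_right_iff _ j] at h3
        simpa [Function.comp_def, Nat.sub_add_cancel (h1 _)] using h3
      · exact (lt_of_range_eq_Iio h4 b).trans_le (h1 a)
  · rintro σ ⟨i, j⟩ hp ⟨i', j'⟩ hp' ⟨-, -, h, -⟩ ⟨-, -, h', -⟩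
    have := Set.Iio_injective (h.symm.trans h')
    simp only [Finset.HasAntidiagonal.mem_antidiagonal] at hp hp' this
    simp only [Prod.mk.injEq]
    omega

theorem countPoly_strictSum {α β : Type*} [Finite α] [Finite β] {V : (α → ℕ) → Prop}
    {W : (β → ℕ) → Prop} (hV : OrderInvariant V) :
    countPoly (StrictSum V W) = countPoly V * countPoly W := by
  ext k
  rw [coeff_countPoly, surjCount_strictSum hV, coeff_mul]
  simp [coeff_countPoly]

theorem surjCount_weakSum {α β : Type*} [Finite α] [Finite β] [Nonempty α] [Nonempty β]
    {V : (α → ℕ) → Prop} {W : (β → ℕ) → Prop} (hV : OrderInvariant V) (k : ℕ) :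
    surjCount (WeakSum V W) k =
      surjCount (StrictSum V W) k + surjCount (StrictSum V W) (k + 1) := by
  let Q : Bool → (α ⊕ β → ℕ) → Prop := fun p σ => Set.range σ = Set.Iio k ∧ WeakSum V W σ ∧
    (p = true ↔ ∃ a b, σ (Sum.inl a) = σ (Sum.inr b))
  have hfin : ∀ p, Finite {σ // Q p σ} := fun p => finite_surj _ k
  rw [surjCount, card_subtype_eq_sum Finset.univ (Q := Q)]
  · rw [Fintype.sum_bool, add_comm]
    congr 1
    · refine Nat.card_congr (Equiv.subtypeEquivRight fun σ => and_congr_right fun _ => ?_)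
      constructor
      · rintro ⟨⟨h1, h2, h3⟩, h4⟩
        simp only [Bool.false_eq_true, false_iff, not_exists] at h4
        exact ⟨h1, h2, fun a b => (h3 a b).lt_of_ne fun h => h4 a b h.symm⟩
      · rintro ⟨h1, h2, h3⟩
        refine ⟨⟨h1, h2, fun a b => (h3 a b).le⟩, ?_⟩
        simp only [Bool.false_eq_true, false_iff, not_exists]
        exact fun a b => (h3 a b).ne'
    · refine Nat.card_congr
        ⟨fun σ => ⟨Sum.elim (fun a => σ.1 (Sum.inl a) + 1) (σ.1 ∘ Sum.inr), ?_⟩,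
          fun σ => ⟨Sum.elim (fun a => σ.1 (Sum.inl a) - 1) (σ.1 ∘ Sum.inr), ?_⟩, ?_, ?_⟩
      · obtain ⟨σ, hr, ⟨h1, h2, h3⟩, h4⟩ := σ
        obtain ⟨a₀, b₀, h₀⟩ := h4.1 rfl
        refine ⟨range_eq_Iio_of ?_ ?_, ?_, h2, ?_⟩
        · rintro (a | b)
          · simpa using lt_of_range_eq_Iio hr (Sum.inl a)
          · have := lt_of_range_eq_Iio hr (Sum.inr b)
            simp only [Sum.elim_inr, Function.comp_apply]
            omega
        · intro c hc
          by_cases hcm : c ≤ σ (Sum.inl a₀)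
          · obtain ⟨x | x, hx⟩ := exists_of_range_eq_Iio hr
              (hcm.trans_lt (lt_of_range_eq_Iio hr (Sum.inl a₀)))
            · have := h3 x b₀
              exact ⟨Sum.inr b₀, by simp only [Sum.elim_inr, Function.comp_apply]; omega⟩
            · exact ⟨Sum.inr x, hx⟩
          · obtain ⟨x | x, hx⟩ := exists_of_range_eq_Iio hr (show c - 1 < k by omega)
            · exact ⟨Sum.inl x, by simp only [Sum.elim_inl]; omega⟩
            · have := h3 a₀ x
              exact ⟨Sum.inl a₀, by simp only [Sum.elim_inl]; omega⟩
        · exact (hV.add_right_iff _ 1).2 h1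
        · intro a b
          have := h3 a b
          simp only [Sum.elim_inl, Sum.elim_inr, Function.comp_apply]
          omega
      · obtain ⟨σ, hr, h1, h2, h3⟩ := σ
        have hpos : ∀ a, 1 ≤ σ (Sum.inl a) := fun a => by
          have := h3 a (Classical.arbitrary β)
          omega
        refine ⟨range_eq_Iio_of ?_ ?_, ⟨?_, h2, ?_⟩, ?_⟩
        · rintro (a | b)
          · have := lt_of_range_eq_Iio hr (Sum.inl a)
            have := hpos a
            simp only [Sum.elim_inl]
            omega
          · have := lt_of_range_eq_Iio hr (Sum.inl (Classical.arbitrary α))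
            have := h3 (Classical.arbitrary α) b
            simp only [Sum.elim_inr, Function.comp_apply]
            omega
        · intro c hc
          obtain ⟨x | x, hx⟩ := exists_of_range_eq_Iio hr (show c < k + 1 by omega)
          · obtain ⟨y | y, hy⟩ := exists_of_range_eq_Iio hr (show c + 1 < k + 1 by omega)
            · exact ⟨Sum.inl y, by simp [hy]⟩
            · have := h3 x y
              omega
          · exact ⟨Sum.inr x, hx⟩
        · rw [← hV.add_right_iff _ 1]
          simpa [Function.comp_def, Nat.sub_add_cancel (hpos _)] using h1
        · intro a b
          have := h3 a b
          simp only [Sum.elim_inl, Sum.elim_inr, Function.comp_apply]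
          omega
        · simp only [true_iff, Sum.elim_inl, Sum.elim_inr, Function.comp_apply]
          obtain ⟨a₀, h₀⟩ := Finite.exists_min fun a => σ (Sum.inl a)
          have hp := hpos a₀
          have := lt_of_range_eq_Iio hr (Sum.inl a₀)
          obtain ⟨x | x, hx⟩ := exists_of_range_eq_Iio hr
            (show σ (Sum.inl a₀) - 1 < k + 1 by omega)
          · have := h₀ x
            omega
          · exact ⟨a₀, x, hx.symm⟩
      · rintro ⟨σ, hσ⟩
        ext (a | b) <;> simp
      · rintro ⟨σ, hr, h1, h2, h3⟩
        ext (a | b)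
        · have := h3 a (Classical.arbitrary β)
          simp only [Sum.elim_inl]
          omega
        · simp
  · intro σ
    constructor
    · rintro ⟨h1, h2⟩
      classical
      exact ⟨decide (∃ a b, σ (Sum.inl a) = σ (Sum.inr b)), Finset.mem_univ _, h1, h2, by simp⟩
    · rintro ⟨p, -, h1, h2, -⟩
      exact ⟨h1, h2⟩
  · rintro σ p - q - ⟨-, -, h⟩ ⟨-, -, h'⟩
    exact Bool.eq_iff_iff.2 (h.trans h'.symm)

theorem X_mul_countPoly_weakSum {α β : Type*} [Finite α] [Finite β] [Nonempty α] [Nonempty β]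
    {V : (α → ℕ) → Prop} {W : (β → ℕ) → Prop} (hV : OrderInvariant V) :
    X * countPoly (WeakSum V W) = (X + 1) * (countPoly V * countPoly W) := by
  rw [← countPoly_strictSum hV, add_mul, one_mul]
  ext (_ | k)
  · simp [coeff_countPoly, surjCount_zero]
  · simp [coeff_countPoly, surjCount_weakSum hV]

/-! ### Disjoint unions -/

theorem card_range_eq_finset {α : Type*} {V : (α → ℕ) → Prop} (hV : OrderInvariant V)
    (S : Finset ℕ) :
    Nat.card {σ : α → ℕ // Set.range σ = S ∧ V σ} = surjCount V S.card := by
  let e := S.orderIsoOfFin rfl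
  let φ : ℕ → ℕ := fun n => if h : n < S.card then (e ⟨n, h⟩ : ℕ) else 0
  let ψ : ℕ → ℕ := fun n => if h : n ∈ S then (e.symm ⟨n, h⟩ : ℕ) else 0
  have hφ : ∀ n, n < S.card → φ n ∈ S ∧ ψ (φ n) = n := by
    intro n hn
    have : φ n = e ⟨n, hn⟩ := dif_pos hn
    have hmem : φ n ∈ S := this ▸ (e ⟨n, hn⟩).2
    refine ⟨hmem, ?_⟩
    simp only [ψ, dif_pos hmem]
    simp [this]
  have hψ : ∀ n, n ∈ S → ψ n < S.card ∧ φ (ψ n) = n := by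
    intro n hn
    have : ψ n = e.symm ⟨n, hn⟩ := dif_pos hn
    have hlt : ψ n < S.card := this ▸ (e.symm ⟨n, hn⟩).2
    refine ⟨hlt, ?_⟩
    simp only [φ, dif_pos hlt]
    simp [this]
  have hφm : StrictMonoOn φ (Set.Iio S.card) := by
    intro a ha b hb hab
    simp only [φ, dif_pos (Set.mem_Iio.1 ha), dif_pos (Set.mem_Iio.1 hb)]
    exact e.strictMono (show (⟨a, ha⟩ : Fin S.card) < ⟨b, hb⟩ from hab)
  have hψm : StrictMonoOn ψ S := by
    intro a ha b hb hab
    simp only [ψ, dif_pos (Finset.mem_coe.1 ha), dif_pos (Finset.mem_coe.1 hb)]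
    exact e.symm.strictMono (show (⟨a, ha⟩ : S) < ⟨b, hb⟩ from hab)
  have himφ : φ '' Set.Iio S.card = S :=
    Set.Subset.antisymm (Set.image_subset_iff.2 fun n hn => (hφ n hn).1)
      fun n hn => ⟨ψ n, (hψ n hn).1, (hψ n hn).2⟩
  have himψ : ψ '' S = Set.Iio S.card :=
    Set.Subset.antisymm (Set.image_subset_iff.2 fun n hn => (hψ n hn).1)
      fun n hn => ⟨φ n, (hφ n hn).1, (hφ n hn).2⟩
  refine Nat.card_congr ⟨fun σ => ⟨ψ ∘ σ.1, ?_, ?_⟩, fun σ => ⟨φ ∘ σ.1, ?_, ?_⟩, ?_, ?_⟩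
  · rw [Set.range_comp, σ.2.1, himψ]
  · exact (hV σ.1 ψ (by rw [σ.2.1]; exact hψm)).2 σ.2.2
  · rw [Set.range_comp, σ.2.1, himφ]
  · exact (hV σ.1 φ (by rw [σ.2.1]; exact hφm)).2 σ.2.2
  · rintro ⟨σ, hr, hσ⟩
    ext x
    exact (hψ _ (mem_of_range_eq_coe hr x)).2
  · rintro ⟨σ, hr, hσ⟩
    ext x
    exact (hφ _ (lt_of_range_eq_Iio hr x)).2

theorem chooseFunctional_countPoly {α : Type*} [Finite α] {V : (α → ℕ) → Prop}
    (hV : OrderInvariant V) (m : ℕ) :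
    chooseFunctional m (countPoly V) = Nat.card {σ : α → ℕ // (∀ x, σ x < m) ∧ V σ} := by
  have hfin (S : Finset ℕ) : Finite {σ : α → ℕ // Set.range σ = S ∧ V σ} :=
    finite_subtype_of_forall_lt (S.sup id + 1) fun σ h x => Nat.lt_succ_of_le
      (Finset.le_sup (f := id) (mem_of_range_eq_coe h.1 x))
  rw [card_subtype_eq_sum (Finset.range m).powerset
    (Q := fun S σ => Set.range σ = (S : Set ℕ) ∧ V σ)]
  · rw [Finset.sum_congr rfl fun S _ => card_range_eq_finset hV S,
      Finset.sum_powerset_apply_card (surjCount V), Finset.card_range, countPoly,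
      chooseFunctional_sum]
    have key : ∀ k, chooseFunctional m (C (surjCount V k : ℝ) * X ^ k) =
        ((m.choose k * surjCount V k : ℕ) : ℝ) := by
      intro k
      have := chooseFunctional_X_pow_mul m k 0
      rw [pow_zero, mul_one, add_zero, add_zero] at this
      rw [← smul_eq_C_mul, chooseFunctional_smul, this]
      push_cast
      ring
    rw [Finset.sum_congr rfl fun k _ => key k]
    push_cast
    simp only [smul_eq_mul, Nat.cast_mul]
    rcases le_total m (Nat.card α) with h | h
    · refine (Finset.sum_subset (Finset.range_mono (by omega)) fun k hk hk' => ?_).symm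
      simp only [Finset.mem_range] at hk'
      rw [Nat.choose_eq_zero_of_lt (by omega)]
      simp
    · refine Finset.sum_subset (Finset.range_mono (by omega)) fun k hk hk' => ?_
      simp only [Finset.mem_range] at hk'
      rw [surjCount_eq_zero_of_card_lt V (by omega)]
      simp
  · intro σ
    constructor
    · rintro ⟨h1, h2⟩
      have := (Set.finite_range σ).coe_toFinset
      refine ⟨(Set.finite_range σ).toFinset, ?_, this.symm, h2⟩
      rw [Finset.mem_powerset]
      intro c hc
      obtain ⟨x, rfl⟩ := (Set.Finite.mem_toFinset _).1 hc
      exact Finset.mem_range.2 (h1 x)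
    · rintro ⟨S, hS, hr, hσ⟩
      refine ⟨fun x => ?_, hσ⟩
      exact Finset.mem_range.1 (Finset.mem_powerset.1 hS
        (mem_of_range_eq_coe hr x))
  · rintro σ S - T - ⟨h, -⟩ ⟨h', -⟩
    exact Finset.coe_injective (h.symm.trans h')

theorem countPoly_disjointSum {α β : Type*} [Finite α] [Finite β] {V : (α → ℕ) → Prop}
    {W : (β → ℕ) → Prop} (hV : OrderInvariant V) (hW : OrderInvariant W) {N : ℕ}
    (hN : Nat.card α < N) :
    countPoly (fun σ : α ⊕ β → ℕ => V (σ ∘ Sum.inl) ∧ W (σ ∘ Sum.inr)) =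
      diamond N (countPoly V) (countPoly W) := by
  refine eq_of_chooseFunctional_eq fun m => ?_
  rw [chooseFunctional_diamond m _ ((natDegree_countPoly_le V).trans_lt hN),
    chooseFunctional_countPoly hV, chooseFunctional_countPoly hW, chooseFunctional_countPoly,
    ← Nat.cast_mul, ← Nat.card_prod]
  · congr 1
    refine Nat.card_congr ⟨fun σ => (⟨_, fun a => σ.2.1 (Sum.inl a), σ.2.2.1⟩,
      ⟨_, fun b => σ.2.1 (Sum.inr b), σ.2.2.2⟩),
      fun τ => ⟨Sum.elim τ.1.1 τ.2.1, ?_, τ.1.2.2, τ.2.2.2⟩, ?_, ?_⟩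
    · rintro (a | b)
      · exact τ.1.2.1 a
      · exact τ.2.2.1 b
    · rintro ⟨σ, hσ⟩
      ext (a | b) <;> rfl
    · rintro ⟨σ, τ⟩
      rfl
  · intro σ φ hφ
    exact and_congr (hV _ φ (hφ.mono (Set.range_comp_subset_range _ _)))
      (hW _ φ (hφ.mono (Set.range_comp_subset_range _ _)))

/-! ### Partitions compatible with a labelled relation -/

/-- `σ` weakly decreases along `r`, and strictly unless `ℓ` holds. -/
def Compat {α : Type*} (r ℓ : α → α → Prop) (σ : α → ℕ) : Prop :=
  ∀ x y, r x y → σ y < σ x ∨ (σ y = σ x ∧ ℓ x y)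

theorem orderInvariant_compat {α : Type*} (r ℓ : α → α → Prop) : OrderInvariant (Compat r ℓ) := by
  intro σ φ hφ
  have h1 : ∀ x y, φ (σ y) < φ (σ x) ↔ σ y < σ x := fun x y => hφ.lt_iff_lt ⟨y, rfl⟩ ⟨x, rfl⟩
  have h2 : ∀ x y, φ (σ y) = φ (σ x) ↔ σ y = σ x := fun x y => hφ.injOn.eq_iff ⟨y, rfl⟩ ⟨x, rfl⟩
  simp only [Compat, Function.comp_apply, h1, h2]

theorem Epoly_eq_countPoly {α : Type*} [PartialOrder α] {ω : α → ℕ} (hω : Function.Injective ω) :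
    Epoly α ω = countPoly (Compat (α := α) (· < ·) fun x y => ω x < ω y) := by
  refine Finset.sum_congr rfl fun k _ => ?_
  congr 3
  refine Nat.card_congr ⟨fun σ => ⟨fun x => (σ.1 x : ℕ), range_eq_Iio_of (fun x => (σ.1 x).2) ?_, ?_⟩,
    fun σ => ⟨fun x => ⟨σ.1 x, lt_of_range_eq_Iio σ.2.1 x⟩, ?_, ?_, ?_⟩, ?_, ?_⟩
  · intro c hc
    obtain ⟨x, hx⟩ := σ.2.1 ⟨c, hc⟩
    exact ⟨x, by simp [hx]⟩
  · intro x y hxy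
    obtain h | h := (Fin.le_def.1 (σ.2.2.1 x y hxy.le)).lt_or_eq
    · exact Or.inl h
    · refine Or.inr ⟨h, ?_⟩
      by_contra! h'
      have := Fin.lt_def.1
        (σ.2.2.2 x y hxy (h'.lt_of_ne fun h'' => hxy.ne (hω h'').symm))
      omega
  · intro c
    obtain ⟨x, hx⟩ := exists_of_range_eq_Iio σ.2.1 c.2
    exact ⟨x, Fin.ext hx⟩
  · intro x y hxy
    rw [Fin.mk_le_mk]
    obtain rfl | h := hxy.eq_or_lt
    · exact le_rfl
    · obtain h | h := σ.2.2 x y h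
      · exact h.le
      · exact h.1.le
  · intro x y hxy hlt
    rw [Fin.mk_lt_mk]
    obtain h | h := σ.2.2 x y hxy
    · exact h
    · exact absurd hlt h.2.not_gt
  · intro σ
    rfl
  · intro σ
    rfl

/-! ### Zeros of the counting polynomials lie in `[-1, 0]` -/

/-- `f` is zero or has the sign `(-1)ⁿ` on `(-∞, -1)`. -/
def AltPos (n : ℕ) (f : ℝ[X]) : Prop :=
  f = 0 ∨ ∀ y < -1, 0 < (-1) ^ n * f.eval y

theorem AltPos.add {n : ℕ} {f g : ℝ[X]} (hf : AltPos n f) (hg : AltPos n g) :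
    AltPos n (f + g) := by
  obtain rfl | hf := hf
  · rwa [zero_add]
  obtain rfl | hg := hg
  · rw [add_zero]
    exact Or.inr hf
  refine Or.inr fun y hy => ?_
  rw [eval_add, mul_add]
  exact add_pos (hf y hy) (hg y hy)

theorem AltPos.mul_left {n : ℕ} {f g : ℝ[X]} (hf : AltPos n f) (hg : ∀ y < -1, g.eval y < 0) :
    AltPos (n + 1) (g * f) := by
  obtain rfl | hf := hf
  · exact Or.inl (mul_zero g)
  refine Or.inr fun y hy => ?_
  rw [eval_mul, pow_succ]
  nlinarith [mul_pos (hf y hy) (neg_pos.2 (hg y hy))]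

theorem countPoly_of_isEmpty {α : Type*} [IsEmpty α] (V : (α → ℕ) → Prop) :
    countPoly V = C (surjCount V 0 : ℝ) := by
  simp [countPoly]

theorem countPoly_of_unique {α : Type*} [Unique α] (V : (α → ℕ) → Prop) :
    countPoly V = C (surjCount V 1 : ℝ) * X := by
  simp [countPoly, Finset.sum_range_succ, surjCount_zero]

theorem surjCount_one_of_unique {α : Type*} [Unique α] {V : (α → ℕ) → Prop} (hV : ∀ σ, V σ) :
    surjCount V 1 = 1 := by
  rw [surjCount, Nat.card_eq_one_iff_unique]
  refine ⟨⟨fun σ τ => ?_⟩, ⟨⟨fun _ => 0, ?_, hV _⟩⟩⟩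
  · ext x
    have := lt_of_range_eq_Iio σ.2.1 x
    have := lt_of_range_eq_Iio τ.2.1 x
    omega
  · exact range_eq_Iio_of (fun _ => zero_lt_one) fun c hc => ⟨default, by omega⟩

theorem countPoly_eq_X {α : Type*} [Unique α] {V : (α → ℕ) → Prop} (hV : ∀ σ, V σ) :
    countPoly V = X := by
  rw [countPoly_of_unique, surjCount_one_of_unique hV, Nat.cast_one, C_1, one_mul]

theorem countPoly_eq_zero {α : Type*} {V : (α → ℕ) → Prop} (hV : ∀ σ, ¬ V σ) :
    countPoly V = 0 := by
  refine Finset.sum_eq_zero fun k _ => ?_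
  have : IsEmpty {σ : α → ℕ // Set.range σ = Set.Iio k ∧ V σ} := ⟨fun σ => hV _ σ.2.2⟩
  rw [surjCount, Nat.card_of_isEmpty, Nat.cast_zero, C_0, zero_mul]

/-- `Compat r` together with the requirement that `t` and `t'` are the last two elements in the
linear order that a partition `σ` and the labelling `ω` induce on `α`. -/
def CompatLastTwo {α : Type*} (r : α → α → Prop) (ω : α → ℕ) (t t' : α) (σ : α → ℕ) : Prop :=
  Compat r (fun x y => ω x < ω y) σ ∧
  (∀ x, x ≠ t → σ t < σ x ∨ (σ t = σ x ∧ ω x < ω t)) ∧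
  ∀ x, x ≠ t → x ≠ t' → σ t' < σ x ∨ (σ t' = σ x ∧ ω x < ω t')

theorem exists_last {α : Type*} [Finite α] (ω : α → ℕ) (hω : Function.Injective ω)
    (σ : α → ℕ) (p : α → Prop) (hp : ∃ x, p x) :
    ∃ t, p t ∧ ∀ x, p x → x ≠ t → σ t < σ x ∨ (σ t = σ x ∧ ω x < ω t) := by
  have : Nonempty {x // p x} := hp.elim fun x hx => ⟨⟨x, hx⟩⟩
  obtain ⟨t, ht⟩ := Finite.exists_max
    fun x : {x // p x} => toLex (OrderDual.toDual (σ x), ω x)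
  refine ⟨t, t.2, fun x hx hne => ?_⟩
  have h := ht ⟨x, hx⟩
  rw [Prod.Lex.toLex_le_toLex] at h
  obtain h | ⟨h, h'⟩ := h
  · exact Or.inl (OrderDual.toDual_lt_toDual.1 h)
  · exact Or.inr ⟨(OrderDual.toDual_inj.1 h).symm, h'.lt_of_ne fun h'' => hne (hω h'')⟩

open Classical in
theorem countPoly_compat_eq_sum {α : Type*} [Fintype α] [Nontrivial α] (r : α → α → Prop)
    {ω : α → ℕ} (hω : Function.Injective ω) :
    countPoly (Compat r fun x y => ω x < ω y) =
      ∑ p ∈ (Finset.univ : Finset α).offDiag, countPoly (CompatLastTwo r ω p.1 p.2) := by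
  ext k
  rw [finsetSum_coeff]
  simp only [coeff_countPoly]
  rw [← Nat.cast_sum]
  congr 1
  have hfin : ∀ p : α × α, Finite
      {σ : α → ℕ // Set.range σ = Set.Iio k ∧ CompatLastTwo r ω p.1 p.2 σ} :=
    fun p => finite_surj _ k
  refine card_subtype_eq_sum _ (Q := fun (p : α × α) (σ : α → ℕ) =>
    Set.range σ = Set.Iio k ∧ CompatLastTwo r ω p.1 p.2 σ) ?_ ?_
  · intro σ
    constructor
    · rintro ⟨h1, h2⟩
      obtain ⟨t, -, ht⟩ := exists_last ω hω σ (fun _ => True) ⟨Classical.arbitrary α, trivial⟩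
      obtain ⟨t', ht'ne, ht'⟩ := exists_last ω hω σ (· ≠ t) (exists_ne t)
      exact ⟨(t, t'), by simpa using ht'ne.symm, h1, h2, fun x => ht x trivial, ht'⟩
    · rintro ⟨p, -, h1, h2, -⟩
      exact ⟨h1, h2⟩
  · rintro σ ⟨t, t'⟩ hp ⟨s, s'⟩ hq ⟨-, -, h1, h2⟩ ⟨-, -, h3, h4⟩
    simp only [Finset.mem_offDiag, Finset.mem_univ, true_and] at hp hq h1 h2 h3 h4
    obtain rfl : t = s := by
      by_contra hne
      have := h1 s (Ne.symm hne)
      have := h3 t hne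
      omega
    obtain rfl : t' = s' := by
      by_contra hne
      have := h2 s' hq.symm (Ne.symm hne)
      have := h4 t' hp.symm hne
      omega
    rfl

theorem countPoly_compatLastTwo_eq_zero {α : Type*} {r : α → α → Prop} {ω : α → ℕ} {t t' y : α}
    (h : r t y) : countPoly (CompatLastTwo r ω t t') = 0 := by
  refine countPoly_eq_zero fun σ hσ => ?_
  have h1 := hσ.1 t y h
  by_cases hy : y = t
  · subst hy
    omega
  · have := hσ.2.1 y hy
    omega

/-- The relation on `α ∖ t` obtained from `r` by making `t'` the last element. -/
def lastRel {α : Type*} (r : α → α → Prop) (t t' : α) (x y : {x : α // x ≠ t}) : Prop :=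
  r x y ∨ (y.1 = t' ∧ x.1 ≠ t')

theorem countPoly_compatLastTwo_of_lt {α : Type*} [Finite α] {r : α → α → Prop} {ω : α → ℕ}
    {t t' : α} (hne : t' ≠ t) (hr : ∀ y, ¬ r t y) (hlt : ω t < ω t') :
    countPoly (CompatLastTwo r ω t t') =
      X * countPoly (Compat (lastRel r t t') fun x y => ω x < ω y) := by
  classical
  have : Unique {x : α // ¬ x ≠ t} := ⟨⟨⟨t, by simp⟩⟩, fun x => Subtype.ext (not_not.1 x.2)⟩
  rw [mul_comm, ← countPoly_eq_X (α := {x : α // ¬ x ≠ t}) (V := fun _ => True) fun _ => trivial,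
    ← countPoly_strictSum (orderInvariant_compat _ _)]
  refine (countPoly_congr (Equiv.sumCompl (· ≠ t)) fun σ => ?_).symm
  constructor
  · rintro ⟨h1, h2, h3⟩
    refine ⟨?_, trivial, ?_⟩
    · rintro ⟨x, hx⟩ ⟨y, hy⟩ (h | ⟨h, h'⟩)
      · exact h1 x y h
      · simp only at h h'
        subst h
        exact h3 x hx h'
    · rintro ⟨x, hx⟩ ⟨y, hy⟩
      obtain rfl := not_not.1 hy
      simp only [Function.comp_apply, Equiv.sumCompl_apply_inr, Equiv.sumCompl_apply_inl]
      have := h2 t' hne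
      by_cases hxt : x = t'
      · subst hxt
        omega
      · have := h3 x hx hxt
        omega
  · rintro ⟨h1, -, h3⟩
    have h3' : ∀ x, x ≠ t → σ t < σ x := fun x hx => h3 ⟨x, hx⟩ ⟨t, by simp⟩
    refine ⟨fun x y hxy => ?_, fun x hx => Or.inl (h3' x hx),
      fun x hx hx' => h1 ⟨x, hx⟩ ⟨t', hne⟩ (Or.inr ⟨rfl, hx'⟩)⟩
    have hx : x ≠ t := by
      rintro rfl
      exact hr y hxy
    by_cases hy : y = t
    · subst hy
      exact Or.inl (h3' x hx)
    · exact h1 ⟨x, hx⟩ ⟨y, hy⟩ (Or.inl hxy)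

theorem countPoly_compatLastTwo_of_gt {α : Type*} [Finite α] {r : α → α → Prop} {ω : α → ℕ}
    {t t' : α} (hne : t' ≠ t) (hr : ∀ y, ¬ r t y) (hlt : ω t' < ω t) :
    countPoly (CompatLastTwo r ω t t') =
      (X + 1) * countPoly (Compat (lastRel r t t') fun x y => ω x < ω y) := by
  classical
  have : Unique {x : α // ¬ x ≠ t} := ⟨⟨⟨t, by simp⟩⟩, fun x => Subtype.ext (not_not.1 x.2)⟩
  have : Nonempty {x : α // x ≠ t} := ⟨⟨t', hne⟩⟩
  have key := X_mul_countPoly_weakSum (W := fun _ : {x : α // ¬ x ≠ t} → ℕ => True)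
    (orderInvariant_compat (lastRel r t t') fun x y => ω x < ω y)
  rw [countPoly_eq_X fun _ => trivial, mul_comm _ X, mul_left_comm] at key
  rw [← mul_left_cancel₀ X_ne_zero key]
  refine (countPoly_congr (Equiv.sumCompl (· ≠ t)) fun σ => ?_).symm
  constructor
  · rintro ⟨h1, h2, h3⟩
    refine ⟨?_, trivial, ?_⟩
    · rintro ⟨x, hx⟩ ⟨y, hy⟩ (h | ⟨h, h'⟩)
      · exact h1 x y h
      · simp only at h h'
        subst h
        exact h3 x hx h'
    · rintro ⟨x, hx⟩ ⟨y, hy⟩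
      obtain rfl := not_not.1 hy
      simp only [Function.comp_apply, Equiv.sumCompl_apply_inr, Equiv.sumCompl_apply_inl]
      have := h2 x hx
      omega
  · rintro ⟨h1, -, h3⟩
    have h3' : ∀ x, x ≠ t → σ t ≤ σ x := fun x hx => h3 ⟨x, hx⟩ ⟨t, by simp⟩
    have hlast : ∀ x, x ≠ t → x ≠ t' → σ t' < σ x ∨ (σ t' = σ x ∧ ω x < ω t') :=
      fun x hx hx' => h1 ⟨x, hx⟩ ⟨t', hne⟩ (Or.inr ⟨rfl, hx'⟩)
    have hmax : ∀ x, x ≠ t → σ t < σ x ∨ (σ t = σ x ∧ ω x < ω t) := by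
      intro x hx
      have := h3' x hx
      have := h3' t' hne
      by_cases hxt : x = t'
      · subst hxt
        omega
      · have := hlast x hx hxt
        omega
    refine ⟨fun x y hxy => ?_, hmax, hlast⟩
    have hx : x ≠ t := by
      rintro rfl
      exact hr y hxy
    by_cases hy : y = t
    · subst hy
      exact hmax x hx
    · exact h1 ⟨x, hx⟩ ⟨y, hy⟩ (Or.inl hxy)

theorem altPos_countPoly_compat {α : Type*} [Finite α] (r : α → α → Prop) {ω : α → ℕ}
    (hω : Function.Injective ω) :
    AltPos (Nat.card α) (countPoly (Compat r fun x y => ω x < ω y)) := by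
  induction hn : Nat.card α generalizing α with
  | zero =>
    have : IsEmpty α := (Nat.card_eq_zero.1 hn).resolve_right (not_infinite_iff_finite.2 ‹_›)
    rw [countPoly_of_isEmpty]
    by_cases h : surjCount (Compat r fun x y => ω x < ω y) 0 = 0
    · exact Or.inl (by simp [h])
    · exact Or.inr fun y _ => by simpa using Nat.pos_of_ne_zero h
  | succ n ih =>
    have := Fintype.ofFinite α
    cases subsingleton_or_nontrivial α with
    | inl hs =>
      have : Nonempty α := (Nat.card_pos_iff.1 (by omega)).1
      have : Inhabited α := Classical.inhabited_of_nonempty this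
      have : Unique α := Unique.mk' α
      have hn0 : n = 0 := by
        rw [Nat.card_unique] at hn
        omega
      subst hn0
      rw [countPoly_of_unique]
      by_cases h : surjCount (Compat r fun x y => ω x < ω y) 1 = 0
      · exact Or.inl (by simp [h])
      · have h' : (0 : ℝ) < surjCount (Compat r fun x y => ω x < ω y) 1 := by
          exact_mod_cast Nat.pos_of_ne_zero h
        refine Or.inr fun y hy => ?_
        simp only [zero_add, pow_one, eval_mul, eval_C, eval_X]
        nlinarith
    | inr hs =>
      classical
      rw [countPoly_compat_eq_sum r hω]
      refine Finset.sum_induction _ (AltPos (n + 1)) (fun _ _ => AltPos.add) (Or.inl rfl) ?_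
      rintro ⟨t, t'⟩ hp
      simp only [Finset.mem_offDiag, Finset.mem_univ, true_and] at hp ⊢
      by_cases hr : ∃ y, r t y
      · exact Or.inl (countPoly_compatLastTwo_eq_zero hr.choose_spec)
      · simp only [not_exists] at hr
        have hcard : Nat.card {x : α // x ≠ t} = n := by
          rw [Nat.card_eq_fintype_card, Fintype.card_subtype_compl, Fintype.card_subtype_eq,
            ← Nat.card_eq_fintype_card, hn, Nat.add_sub_cancel]
        have key := ih (lastRel r t t') (ω := fun x => ω x.1)
          (hω.comp Subtype.val_injective) hcard
        obtain h | h := (hω.ne hp).lt_or_gt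
        · rw [countPoly_compatLastTwo_of_lt hp.symm hr h]
          exact key.mul_left fun y hy => by simp only [eval_X]; linarith
        · rw [countPoly_compatLastTwo_of_gt hp.symm hr h]
          exact key.mul_left fun y hy => by simp only [eval_add, eval_X, eval_one]; linarith

theorem leadingCoeff_countPoly_pos {α : Type*} [Finite α] {V : (α → ℕ) → Prop}
    (h : countPoly V ≠ 0) : 0 < (countPoly V).leadingCoeff := by
  refine lt_of_le_of_ne ?_ (leadingCoeff_ne_zero.2 h).symm
  rw [leadingCoeff, coeff_countPoly]
  positivity

theorem le_zero_of_isRoot_countPoly {α : Type*} [Finite α] {V : (α → ℕ) → Prop}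
    (h : countPoly V ≠ 0) {b : ℝ} (hb : (countPoly V).IsRoot b) : b ≤ 0 := by
  by_contra! hpos
  refine (ne_of_gt ?_) hb
  rw [eval_eq_sum_range]
  refine Finset.sum_pos' (fun k _ => ?_) ⟨(countPoly V).natDegree, by simp, ?_⟩
  · rw [coeff_countPoly]
    positivity
  · exact mul_pos (leadingCoeff_countPoly_pos h) (pow_pos hpos _)

theorem leadingCoeff_Epoly_pos {α : Type*} [PartialOrder α] [Finite α] {ω : α → ℕ}
    (hω : Function.Injective ω) (h : RealRooted (Epoly α ω)) : 0 < (Epoly α ω).leadingCoeff := by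
  have h0 := h.1
  rw [Epoly_eq_countPoly hω] at h0 ⊢
  exact leadingCoeff_countPoly_pos h0

theorem mem_Icc_of_isRoot_Epoly {α : Type*} [PartialOrder α] [Finite α] {ω : α → ℕ}
    (hω : Function.Injective ω) (h : RealRooted (Epoly α ω)) (b : ℝ) (hb : (Epoly α ω).IsRoot b) :
    b ∈ Set.Icc (-1 : ℝ) 0 := by
  have h0 := h.1
  rw [Epoly_eq_countPoly hω] at h0 hb
  refine ⟨?_, le_zero_of_isRoot_countPoly h0 hb⟩
  by_contra! hlt
  have := (altPos_countPoly_compat (α := α) (· < ·) hω).resolve_left h0 b hlt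
  rw [hb, mul_zero] at this
  exact this.false

/-! ### Labelled posets decomposed into two parts -/

/-- `e` identifies `α` and `β` with complementary labelled subposets of `γ`. -/
structure IsSumDecomposition {α β γ : Type*} [PartialOrder α] [PartialOrder β] [PartialOrder γ]
    (e : α ⊕ β ≃ γ) (ω : α → ℕ) (ν : β → ℕ) (μ : γ → ℕ) : Prop where
  inl_lt_inl : ∀ x y, e (Sum.inl x) < e (Sum.inl y) ↔ x < y
  inr_lt_inr : ∀ x y, e (Sum.inr x) < e (Sum.inr y) ↔ x < y
  label_inl : ∀ x y, μ (e (Sum.inl x)) < μ (e (Sum.inl y)) ↔ ω x < ω y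
  label_inr : ∀ x y, μ (e (Sum.inr x)) < μ (e (Sum.inr y)) ↔ ν x < ν y
  injective_inl : Function.Injective ω
  injective_inr : Function.Injective ν
  injective : Function.Injective μ

/-- Removal of a point of the first part. -/
noncomputable def eraseInl {α β γ : Type*} (e : α ⊕ β ≃ γ) (a : α) :
    {x : α // x ≠ a} ⊕ β ≃ {p : γ // p ≠ e (Sum.inl a)} :=
  Equiv.ofBijective
    (Sum.elim (fun x => ⟨e (Sum.inl x), by simpa using x.2⟩) fun b => ⟨e (Sum.inr b), by simp⟩) <| by
    constructor
    · rintro (⟨x, hx⟩ | x) (⟨y, hy⟩ | y) h <;> simp_all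
    · rintro ⟨p, hp⟩
      obtain ⟨x | x, rfl⟩ := e.surjective p
      · exact ⟨Sum.inl ⟨x, by simpa using hp⟩, rfl⟩
      · exact ⟨Sum.inr x, rfl⟩

/-- Removal of a point of the second part. -/
noncomputable def eraseInr {α β γ : Type*} (e : α ⊕ β ≃ γ) (b : β) :
    α ⊕ {x : β // x ≠ b} ≃ {p : γ // p ≠ e (Sum.inr b)} :=
  Equiv.ofBijective
    (Sum.elim (fun a => ⟨e (Sum.inl a), by simp⟩) fun x => ⟨e (Sum.inr x), by simpa using x.2⟩) <| by
    constructor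
    · rintro (x | ⟨x, hx⟩) (y | ⟨y, hy⟩) h <;> simp_all
    · rintro ⟨p, hp⟩
      obtain ⟨x | x, rfl⟩ := e.surjective p
      · exact ⟨Sum.inl x, rfl⟩
      · exact ⟨Sum.inr ⟨x, by simpa using hp⟩, rfl⟩

section Decomposition

variable {α β γ : Type*} [PartialOrder α] [PartialOrder β] [PartialOrder γ]
  {e : α ⊕ β ≃ γ} {ω : α → ℕ} {ν : β → ℕ} {μ : γ → ℕ}

theorem IsSumDecomposition.eraseInl (H : IsSumDecomposition e ω ν μ) (a : α) :
    IsSumDecomposition (eraseInl e a) (fun x => ω x.1) ν (fun p => μ p.1) where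
  inl_lt_inl x y := H.inl_lt_inl x y
  inr_lt_inr := H.inr_lt_inr
  label_inl x y := H.label_inl x y
  label_inr := H.label_inr
  injective_inl := H.injective_inl.comp Subtype.val_injective
  injective_inr := H.injective_inr
  injective := H.injective.comp Subtype.val_injective

theorem IsSumDecomposition.eraseInr (H : IsSumDecomposition e ω ν μ) (b : β) :
    IsSumDecomposition (eraseInr e b) ω (fun x => ν x.1) (fun p => μ p.1) where
  inl_lt_inl := H.inl_lt_inl
  inr_lt_inr x y := H.inr_lt_inr x y
  label_inl := H.label_inl
  label_inr x y := H.label_inr x y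
  injective_inl := H.injective_inl
  injective_inr := H.injective_inr.comp Subtype.val_injective
  injective := H.injective.comp Subtype.val_injective

/-- Compatibility on `γ` splits into compatibility on both parts and a condition on mixed pairs. -/
theorem IsSumDecomposition.compat_iff (H : IsSumDecomposition e ω ν μ) (σ : γ → ℕ) :
    Compat (· < ·) (fun x y => μ x < μ y) σ ↔
      Compat (· < ·) (fun x y => ω x < ω y) ((σ ∘ e) ∘ Sum.inl) ∧
      Compat (· < ·) (fun x y => ν x < ν y) ((σ ∘ e) ∘ Sum.inr) ∧
      ∀ a b, (e (Sum.inl a) < e (Sum.inr b) → σ (e (Sum.inr b)) < σ (e (Sum.inl a)) ∨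
          (σ (e (Sum.inr b)) = σ (e (Sum.inl a)) ∧ μ (e (Sum.inl a)) < μ (e (Sum.inr b)))) ∧
        (e (Sum.inr b) < e (Sum.inl a) → σ (e (Sum.inl a)) < σ (e (Sum.inr b)) ∨
          (σ (e (Sum.inl a)) = σ (e (Sum.inr b)) ∧ μ (e (Sum.inr b)) < μ (e (Sum.inl a)))) := by
  simp only [Compat, ← e.forall_congr_right, Sum.forall, H.inl_lt_inl, H.inr_lt_inr, H.label_inl,
    H.label_inr, Function.comp_apply]
  constructor
  · rintro ⟨h1, h2⟩
    exact ⟨fun x => (h1 x).1, fun x => (h2 x).2, fun a b => ⟨(h1 a).2 b, (h2 b).1 a⟩⟩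
  · rintro ⟨h1, h2, h3⟩
    exact ⟨fun x => ⟨h1 x, fun b => (h3 x b).1⟩, fun b => ⟨fun a => (h3 a b).2, h2 b⟩⟩

theorem IsSumDecomposition.Epoly_of_isEmpty_inl [IsEmpty α] [Finite β]
    (H : IsSumDecomposition e ω ν μ) :
    Epoly γ μ = Epoly β ν := by
  rw [Epoly_eq_countPoly H.injective, Epoly_eq_countPoly H.injective_inr]
  refine (countPoly_congr ((Equiv.emptySum α β).symm.trans e) fun σ => ?_).symm
  rw [H.compat_iff]
  exact ⟨fun h => h.2.1, fun h => ⟨fun x => isEmptyElim x, h, fun a => isEmptyElim a⟩⟩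

theorem IsSumDecomposition.Epoly_of_isEmpty_inr [IsEmpty β] [Finite α]
    (H : IsSumDecomposition e ω ν μ) :
    Epoly γ μ = Epoly α ω := by
  rw [Epoly_eq_countPoly H.injective, Epoly_eq_countPoly H.injective_inl]
  refine (countPoly_congr ((Equiv.sumEmpty α β).symm.trans e) fun σ => ?_).symm
  rw [H.compat_iff]
  exact ⟨fun h => h.1, fun h => ⟨h, fun x => isEmptyElim x, fun _ b => isEmptyElim b⟩⟩

variable [Finite α] [Finite β]

theorem IsSumDecomposition.Epoly_strict (H : IsSumDecomposition e ω ν μ)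
    (hlt : ∀ a b, e (Sum.inl a) < e (Sum.inr b))
    (hμ : ∀ a b, μ (e (Sum.inr b)) < μ (e (Sum.inl a))) :
    Epoly γ μ = Epoly α ω * Epoly β ν := by
  rw [Epoly_eq_countPoly H.injective, Epoly_eq_countPoly H.injective_inl,
    Epoly_eq_countPoly H.injective_inr, ← countPoly_strictSum (orderInvariant_compat _ _)]
  refine (countPoly_congr e fun σ => ?_).symm
  rw [H.compat_iff]
  refine and_congr_right fun _ => and_congr_right fun _ => forall₂_congr fun a b => ?_
  simp [hlt a b, (hlt a b).not_gt, (hμ a b).not_gt]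

theorem IsSumDecomposition.X_mul_Epoly_weak [Nonempty α] [Nonempty β]
    (H : IsSumDecomposition e ω ν μ) (hlt : ∀ a b, e (Sum.inl a) < e (Sum.inr b))
    (hμ : ∀ a b, μ (e (Sum.inl a)) < μ (e (Sum.inr b))) :
    X * Epoly γ μ = (X + 1) * (Epoly α ω * Epoly β ν) := by
  rw [Epoly_eq_countPoly H.injective, Epoly_eq_countPoly H.injective_inl,
    Epoly_eq_countPoly H.injective_inr, ← X_mul_countPoly_weakSum (orderInvariant_compat _ _)]
  congr 1
  refine (countPoly_congr e fun σ => ?_).symm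
  rw [H.compat_iff]
  refine and_congr_right fun _ => and_congr_right fun _ => forall₂_congr fun a b => ?_
  simp [hlt a b, (hlt a b).not_gt, hμ a b, le_iff_lt_or_eq]

theorem IsSumDecomposition.Epoly_disjoint (H : IsSumDecomposition e ω ν μ)
    (h1 : ∀ a b, ¬ e (Sum.inl a) < e (Sum.inr b)) (h2 : ∀ a b, ¬ e (Sum.inr b) < e (Sum.inl a))
    {N : ℕ} (hN : Nat.card α < N) :
    Epoly γ μ = diamond N (Epoly α ω) (Epoly β ν) := by
  rw [Epoly_eq_countPoly H.injective, Epoly_eq_countPoly H.injective_inl,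
    Epoly_eq_countPoly H.injective_inr,
    ← countPoly_disjointSum (orderInvariant_compat _ _) (orderInvariant_compat _ _) hN]
  refine (countPoly_congr e fun σ => ?_).symm
  rw [H.compat_iff]
  simp [h1, h2]

end Decomposition

theorem RealRooted.of_mul_right {f g : ℝ[X]} (h : RealRooted (f * g)) : RealRooted g :=
  ⟨right_ne_zero_of_mul h.1, fun z hz => h.2 z (by
    rw [Polynomial.map_mul]
    exact root_mul_left_of_isRoot _ hz)⟩

theorem realRooted_X_add_one : RealRooted (X + 1) := by
  refine ⟨(monic_X_add_C (1 : ℝ)).ne_zero, fun z hz => ?_⟩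
  simp only [Polynomial.map_add, map_X, Polynomial.map_one, IsRoot.def, eval_add, eval_X,
    eval_one] at hz
  simp [eq_neg_of_add_eq_zero_left hz]

theorem leadingCoeff_X_add_one_mul (q : ℝ[X]) : ((X + 1) * q).leadingCoeff = q.leadingCoeff := by
  rw [← C_1, leadingCoeff_monic_mul (monic_X_add_C 1)]

theorem exists_Epoly_eq_X_mul {α : Type*} [PartialOrder α] [Finite α] [Nonempty α] {ω : α → ℕ}
    (hω : Function.Injective ω) : ∃ q, Epoly α ω = X * q := by
  refine X_dvd_iff.2 ?_
  rw [Epoly_eq_countPoly hω, coeff_countPoly, surjCount_zero, Nat.cast_zero]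

theorem Epoly_of_unique {α : Type*} [PartialOrder α] [Unique α] {ω : α → ℕ}
    (hω : Function.Injective ω) : Epoly α ω = X := by
  rw [Epoly_eq_countPoly hω]
  refine countPoly_eq_X fun σ x y hxy => ?_
  exact absurd hxy (by simp [Subsingleton.elim x y])

theorem Epoly_of_isEmpty_erase {α : Type*} [PartialOrder α] {ω : α → ℕ}
    (hω : Function.Injective ω) (a : α) [IsEmpty {x : α // x ≠ a}] : Epoly α ω = X := by
  have : Unique α := ⟨⟨a⟩, fun x => by_contra fun h => isEmptyElim (⟨x, h⟩ : {x : α // x ≠ a})⟩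
  exact Epoly_of_unique hω

theorem MemI.leadingCoeff_pos {α : Type*} [PartialOrder α] [Finite α] {ω : α → ℕ}
    (h : MemI α ω) : 0 < (Epoly α ω).leadingCoeff :=
  leadingCoeff_Epoly_pos h.1 h.2.1

theorem MemI.leadingCoeff_erase_pos {α : Type*} [PartialOrder α] [Finite α] {ω : α → ℕ}
    (h : MemI α ω) (a : α) : 0 < (Epoly {x : α // x ≠ a} fun x => ω x.1).leadingCoeff :=
  leadingCoeff_Epoly_pos (h.1.comp Subtype.val_injective) (h.2.2 a).2.1

theorem MemI.natDegree_le {α : Type*} [PartialOrder α] [Finite α] {ω : α → ℕ}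
    (h : MemI α ω) : (Epoly α ω).natDegree ≤ Nat.card α := by
  rw [Epoly_eq_countPoly h.1]
  exact natDegree_countPoly_le _

section Closure

variable {α β γ : Type*} [PartialOrder α] [PartialOrder β] [PartialOrder γ]
  [Finite α] [Finite β] [Finite γ]
  {e : α ⊕ β ≃ γ} {ω : α → ℕ} {ν : β → ℕ} {μ : γ → ℕ}

theorem IsSumDecomposition.memI_strict (H : IsSumDecomposition e ω ν μ) (hP : MemI α ω)
    (hQ : MemI β ν) (hlt : ∀ a b, e (Sum.inl a) < e (Sum.inr b))
    (hμ : ∀ a b, μ (e (Sum.inr b)) < μ (e (Sum.inl a))) : MemI γ μ := by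
  have hE := H.Epoly_strict hlt hμ
  refine ⟨H.injective, hE ▸ hP.2.1.mul hQ.2.1, fun p => ?_⟩
  obtain ⟨a | b, rfl⟩ := e.surjective p
  · rw [hE, (H.eraseInl a).Epoly_strict (fun x y => hlt x y) fun x y => hμ x y]
    exact (hP.2.2 a).mul_right hQ.2.1 hP.leadingCoeff_pos (hP.leadingCoeff_erase_pos a)
      hQ.leadingCoeff_pos
  · rw [hE, (H.eraseInr b).Epoly_strict (fun x y => hlt x y) fun x y => hμ x y,
      mul_comm, mul_comm (Epoly α ω)]
    exact (hQ.2.2 b).mul_right hP.2.1 hQ.leadingCoeff_pos (hQ.leadingCoeff_erase_pos b)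
      hP.leadingCoeff_pos

theorem IsSumDecomposition.memI_disjoint (H : IsSumDecomposition e ω ν μ) (hP : MemI α ω)
    (hQ : MemI β ν) (h1 : ∀ a b, ¬ e (Sum.inl a) < e (Sum.inr b))
    (h2 : ∀ a b, ¬ e (Sum.inr b) < e (Sum.inl a)) : MemI γ μ := by
  have hNα : Nat.card α < Nat.card α + Nat.card β + 1 := by omega
  have hNβ : Nat.card β < Nat.card α + Nat.card β + 1 := by omega
  have hE := H.Epoly_disjoint h1 h2 hNα
  have hPd := hP.natDegree_le.trans_lt hNα
  have hQd := hQ.natDegree_le.trans_lt hNβ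
  refine ⟨H.injective, ?_, fun p => ?_⟩
  · rw [hE]
    exact hP.2.1.diamond hQ.2.1 (mem_Icc_of_isRoot_Epoly hQ.1 hQ.2.1) hQd
  obtain ⟨a | b, rfl⟩ := e.surjective p
  · rw [hE, (H.eraseInl a).Epoly_disjoint (fun x y => h1 x y) (fun x y => h2 x y)
      ((Nat.card_le_card_of_injective _ Subtype.val_injective).trans_lt hNα)]
    exact (hP.2.2 a).diamond_right hQ.2.1 (mem_Icc_of_isRoot_Epoly hQ.1 hQ.2.1)
      hP.leadingCoeff_pos (hP.leadingCoeff_erase_pos a) hQ.leadingCoeff_pos hQd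
  · rw [hE, (H.eraseInr b).Epoly_disjoint (fun x y => h1 x y) (fun x y => h2 x y) hNα,
      diamond_comm, diamond_comm _ (Epoly α ω)]
    exact (hQ.2.2 b).diamond_right hP.2.1 (mem_Icc_of_isRoot_Epoly hP.1 hP.2.1)
      hQ.leadingCoeff_pos (hQ.leadingCoeff_erase_pos b) hP.leadingCoeff_pos hPd

theorem IsSumDecomposition.memI_weak (H : IsSumDecomposition e ω ν μ) (hP : MemI α ω)
    (hQ : MemI β ν) (hlt : ∀ a b, e (Sum.inl a) < e (Sum.inr b))
    (hμ : ∀ a b, μ (e (Sum.inl a)) < μ (e (Sum.inr b))) : MemI γ μ := by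
  cases isEmpty_or_nonempty α with
  | inl hα =>
    refine ⟨H.injective, H.Epoly_of_isEmpty_inl ▸ hQ.2.1, fun p => ?_⟩
    obtain ⟨a | b, rfl⟩ := e.surjective p
    · exact isEmptyElim a
    · rw [H.Epoly_of_isEmpty_inl, (H.eraseInr b).Epoly_of_isEmpty_inl]
      exact hQ.2.2 b
  | inr hα =>
    cases isEmpty_or_nonempty β with
    | inl hβ =>
      refine ⟨H.injective, H.Epoly_of_isEmpty_inr ▸ hP.2.1, fun p => ?_⟩
      obtain ⟨a | b, rfl⟩ := e.surjective p
      · rw [H.Epoly_of_isEmpty_inr, (H.eraseInl a).Epoly_of_isEmpty_inr]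
        exact hP.2.2 a
      · exact isEmptyElim b
    | inr hβ =>
      obtain ⟨f, hf⟩ := exists_Epoly_eq_X_mul hP.1
      obtain ⟨g, hg⟩ := exists_Epoly_eq_X_mul hQ.1
      have hfr : RealRooted ((X + 1) * f) :=
        realRooted_X_add_one.mul (hf ▸ hP.2.1).of_mul_right
      have hgr : RealRooted ((X + 1) * g) :=
        realRooted_X_add_one.mul (hg ▸ hQ.2.1).of_mul_right
      have hfl : 0 < ((X + 1) * f).leadingCoeff := by
        have := hP.leadingCoeff_pos
        rwa [hf, leadingCoeff_monic_mul monic_X, ← leadingCoeff_X_add_one_mul] at this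
      have hgl : 0 < ((X + 1) * g).leadingCoeff := by
        have := hQ.leadingCoeff_pos
        rwa [hg, leadingCoeff_monic_mul monic_X, ← leadingCoeff_X_add_one_mul] at this
      have hXE := H.X_mul_Epoly_weak hlt hμ
      have hEα : Epoly γ μ = Epoly α ω * ((X + 1) * g) := by
        refine mul_left_cancel₀ X_ne_zero (hXE.trans ?_)
        rw [hg]
        ring
      have hEβ : Epoly γ μ = Epoly β ν * ((X + 1) * f) := by
        refine mul_left_cancel₀ X_ne_zero (hXE.trans ?_)
        rw [hf]
        ring
      refine ⟨H.injective, hEα ▸ hP.2.1.mul hgr, fun p => ?_⟩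
      obtain ⟨a | b, rfl⟩ := e.surjective p
      · have H' := H.eraseInl a
        cases isEmpty_or_nonempty {x : α // x ≠ a} with
        | inl hα' =>
          have hE : Epoly γ μ = (X + C 1) * Epoly β ν := by
            rw [hEα, hg, Epoly_of_isEmpty_erase hP.1 a, C_1]
            ring
          rw [H'.Epoly_of_isEmpty_inl, hE]
          exact interlaces_X_add_C_mul hQ.2.1 hQ.leadingCoeff_pos 1
        | inr hα' =>
          have hE' := H'.X_mul_Epoly_weak (fun x y => hlt x y) fun x y => hμ x y
          rw [hg, mul_left_comm _ X, mul_left_comm _ X] at hE'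
          rw [mul_left_cancel₀ X_ne_zero hE', hEα, mul_left_comm]
          exact (hP.2.2 a).mul_right hgr hP.leadingCoeff_pos (hP.leadingCoeff_erase_pos a) hgl
      · have H' := H.eraseInr b
        cases isEmpty_or_nonempty {x : β // x ≠ b} with
        | inl hβ' =>
          have hE : Epoly γ μ = (X + C 1) * Epoly α ω := by
            rw [hEβ, hf, Epoly_of_isEmpty_erase hQ.1 b, C_1]
            ring
          rw [H'.Epoly_of_isEmpty_inr, hE]
          exact interlaces_X_add_C_mul hP.2.1 hP.leadingCoeff_pos 1
        | inr hβ' =>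
          have hE' := H'.X_mul_Epoly_weak (fun x y => hlt x y) fun x y => hμ x y
          rw [hf, mul_assoc X, mul_left_comm _ X] at hE'
          rw [mul_left_cancel₀ X_ne_zero hE', hEβ, mul_comm f, mul_left_comm]
          exact (hQ.2.2 b).mul_right hfr hQ.leadingCoeff_pos (hQ.leadingCoeff_erase_pos b) hfl

end Closure

/-- An injective labelling is reflected by any map that preserves its strict comparisons. -/
theorem lt_iff_lt_of_injective {α : Type*} {ω μ : α → ℕ} (hω : Function.Injective ω)
    (h : ∀ x y, ω x < ω y → μ x < μ y) (x y : α) : μ x < μ y ↔ ω x < ω y := by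
  refine ⟨fun hxy => ?_, h x y⟩
  by_contra! hle
  obtain hlt | heq := hle.lt_or_eq
  · exact absurd (h y x hlt) hxy.not_gt
  · obtain rfl := hω heq
    exact hxy.false

/-- **Theorem 3.2.** The class `𝓘` is closed under ordinal sum (with either labelling
`ω ⊕₀ ν` or `ω ⊕₁ ν`) and disjoint union. -/
theorem memI_closed_under_sums (α β : Type) [PartialOrder α] [PartialOrder β]
    [Finite α] [Finite β]
    (ω : α → ℕ) (ν : β → ℕ) (hP : MemI α ω) (hQ : MemI β ν)
    -- a labelling `ω ⊕₀ ν` of the ordinal sum, with labels increasing from `P` to `Q`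
    (μ₀ : α ⊕ β → ℕ) (hμ₀ : Function.Injective μ₀)
    (h01 : ∀ x y : α, ω x < ω y → μ₀ (Sum.inl x) < μ₀ (Sum.inl y))
    (h02 : ∀ x y : β, ν x < ν y → μ₀ (Sum.inr x) < μ₀ (Sum.inr y))
    (h03 : ∀ (x : α) (y : β), μ₀ (Sum.inl x) < μ₀ (Sum.inr y))
    -- a labelling `ω ⊕₁ ν` of the ordinal sum, with labels increasing from `Q` to `P`
    (μ₁ : α ⊕ β → ℕ) (hμ₁ : Function.Injective μ₁)
    (h11 : ∀ x y : α, ω x < ω y → μ₁ (Sum.inl x) < μ₁ (Sum.inl y))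
    (h12 : ∀ x y : β, ν x < ν y → μ₁ (Sum.inr x) < μ₁ (Sum.inr y))
    (h13 : ∀ (x : β) (y : α), μ₁ (Sum.inr x) < μ₁ (Sum.inl y))
    -- a labelling `ω ⊔ ν` of the disjoint union
    (μ : α ⊕ β → ℕ) (hμ : Function.Injective μ)
    (h1 : ∀ x y : α, ω x < ω y → μ (Sum.inl x) < μ (Sum.inl y))
    (h2 : ∀ x y : β, ν x < ν y → μ (Sum.inr x) < μ (Sum.inr y)) :
    MemI (α ⊕ₗ β) (fun p => μ₀ (ofLex p)) ∧
    MemI (α ⊕ₗ β) (fun p => μ₁ (ofLex p)) ∧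
    MemI (α ⊕ β) μ := by
  have hdec : ∀ κ : α ⊕ β → ℕ, Function.Injective κ →
      (∀ x y : α, ω x < ω y → κ (Sum.inl x) < κ (Sum.inl y)) →
      (∀ x y : β, ν x < ν y → κ (Sum.inr x) < κ (Sum.inr y)) →
      IsSumDecomposition (γ := α ⊕ₗ β) toLex ω ν fun p => κ (ofLex p) :=
    fun κ hκ hl hr =>
      ⟨fun _ _ => Sum.Lex.inl_lt_inl_iff, fun _ _ => Sum.Lex.inr_lt_inr_iff,
        lt_iff_lt_of_injective hP.1 hl, lt_iff_lt_of_injective hQ.1 hr, hP.1, hQ.1,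
        hκ.comp ofLex.injective⟩
  refine ⟨(hdec μ₀ hμ₀ h01 h02).memI_weak hP hQ (fun _ _ => Sum.Lex.inl_lt_inr _ _) h03,
    (hdec μ₁ hμ₁ h11 h12).memI_strict hP hQ (fun _ _ => Sum.Lex.inl_lt_inr _ _)
      fun a b => h13 b a, ?_⟩
  have hdisj : IsSumDecomposition (Equiv.refl (α ⊕ β)) ω ν μ :=
    ⟨fun _ _ => Sum.inl_lt_inl_iff, fun _ _ => Sum.inr_lt_inr_iff,
      lt_iff_lt_of_injective hP.1 h1, lt_iff_lt_of_injective hQ.1 h2, hP.1, hQ.1, hμ⟩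
  exact hdisj.memI_disjoint hP hQ (fun _ _ => Sum.not_inl_lt_inr) fun _ _ => Sum.not_inr_lt_inl
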